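/- arXiv:2203.13748 — 2 statements merged into one kernel-verified Lean document; each statement's English description precedes it below -/
import Mathlib

section
/- There is an absolute constant C₀ such that for all integrable functions ρ, φ : [−1,1] → ℝ one has ‖𝐂[ρ] − 𝐂[φ]‖_{L¹[−1,1]} ≤ C₀ (‖ρ‖_{L¹[−1,1]} + ‖φ‖_{L¹[−1,1]})² · ‖ρ − φ‖_{L¹[−1,1]}. In particular, the map ρ ↦ 𝐂[ρ] is locally Lipschitz on L¹[−1,1]. -/
open MeasureTheory

/-- Density of the semicircle measure `σ_sc`. -/
noncomputable def scDensity (x : ℝ) : ℝ := (1 / (2 * Real.pi)) * Real.sqrt (max (4 - x ^ 2) 0)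

/-- `ν : [-1,1] → [-2,2]` is the strictly increasing continuous function with
`∫_0^{ν k} dσ_sc = k/2`. -/
def IsNu (ν : ℝ → ℝ) : Prop :=
  (∀ k ∈ Set.Icc (-1 : ℝ) 1, ν k ∈ Set.Icc (-2 : ℝ) 2) ∧
    StrictMonoOn ν (Set.Icc (-1 : ℝ) 1) ∧
      ContinuousOn ν (Set.Icc (-1 : ℝ) 1) ∧
        ∀ k ∈ Set.Icc (-1 : ℝ) 1, (∫ x in (0 : ℝ)..(ν k), scDensity x) = k / 2

/-- `νinv` is an inverse for `ν` on `[-2,2]`. -/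
def IsNuInv (ν νinv : ℝ → ℝ) : Prop :=
  ∀ x ∈ Set.Icc (-2 : ℝ) 2, νinv x ∈ Set.Icc (-1 : ℝ) 1 ∧ ν (νinv x) = x

/-- The collision operator of the kinetic wave equation, with the delta function resolved in the
variable `n = νinv (ν k - ν ℓ + ν m)`. -/
noncomputable def collision (ν νinv : ℝ → ℝ) (ρ : ℝ → ℝ) (k : ℝ) : ℝ :=
  (1 / 2) *
    ∫ p in Set.Icc (-1 : ℝ) 1 ×ˢ Set.Icc (-1 : ℝ) 1,
      (if |ν k - ν p.1 + ν p.2| ≤ 2 then Real.sqrt (4 - (ν k - ν p.1 + ν p.2) ^ 2) else 0) *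
        (ρ p.1 * ρ p.2 * ρ (νinv (ν k - ν p.1 + ν p.2)) -
            ρ k * ρ p.2 * ρ (νinv (ν k - ν p.1 + ν p.2)) +
            ρ k * ρ p.1 * ρ (νinv (ν k - ν p.1 + ν p.2)) -
            ρ k * ρ p.1 * ρ p.2)


namespace ScAux

/-- Cut-off square root. -/
noncomputable def S (w : ℝ) : ℝ := Real.sqrt (4 - w ^ 2)

/-- Twice the primitive of the semicircle density. -/
noncomputable def F (x : ℝ) : ℝ := 2 * ∫ t in (0 : ℝ)..x, scDensity t

/-- Lebesgue measure on `[-1,1]`. -/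
noncomputable def mu : Measure ℝ := volume.restrict (Set.Icc (-1 : ℝ) 1)

instance : IsFiniteMeasure mu := by unfold mu; infer_instance

lemma S_nonneg (w : ℝ) : 0 ≤ S w := Real.sqrt_nonneg _

lemma S_le (w : ℝ) : S w ≤ 2 := by
  unfold S
  rw [Real.sqrt_le_left (by norm_num)]
  nlinarith [sq_nonneg w]

lemma S_cont : Continuous S := by unfold S; fun_prop

lemma S_zero {w : ℝ} (h : ¬ |w| ≤ 2) : S w = 0 := by
  unfold S
  apply Real.sqrt_eq_zero_of_nonpos
  push Not at h
  have : w ^ 2 = |w| ^ 2 := (sq_abs w).symm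
  nlinarith

lemma dens_eq (x : ℝ) : 2 * scDensity x = S x / Real.pi := by
  unfold scDensity S
  have : Real.sqrt (max (4 - x ^ 2) 0) = Real.sqrt (4 - x ^ 2) := by
    rcases le_total (4 - x ^ 2) 0 with h | h
    · rw [max_eq_right h, Real.sqrt_eq_zero_of_nonpos h, Real.sqrt_zero]
    · rw [max_eq_left h]
  rw [this]
  have := Real.pi_ne_zero
  field_simp

lemma dens_cont : Continuous scDensity := by unfold scDensity; fun_prop

lemma F_deriv (x : ℝ) : HasDerivAt F (S x / Real.pi) x := by
  rw [← dens_eq]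
  exact (intervalIntegral.integral_hasDerivAt_right (dens_cont.intervalIntegrable _ _)
    (dens_cont.stronglyMeasurableAtFilter _ _) dens_cont.continuousAt).const_mul 2

lemma F_cont : Continuous F := continuous_iff_continuousAt.2 fun x => (F_deriv x).continuousAt


lemma F_eq {ν νinv : ℝ → ℝ} (h1 : IsNu ν) (h2 : IsNuInv ν νinv)
    {x : ℝ} (hx : x ∈ Set.Icc (-2 : ℝ) 2) : F x = νinv x := by
  obtain ⟨a, b⟩ := h2 x hx
  have := h1.2.2.2 _ a
  rw [b] at this
  unfold F
  rw [this]; ring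

lemma nu_F {ν νinv : ℝ → ℝ} (h1 : IsNu ν) (h2 : IsNuInv ν νinv)
    {x : ℝ} (hx : x ∈ Set.Icc (-2 : ℝ) 2) : ν (F x) = x := by
  rw [F_eq h1 h2 hx]; exact (h2 x hx).2

lemma F_inj {ν νinv : ℝ → ℝ} (h1 : IsNu ν) (h2 : IsNuInv ν νinv)
    : Set.InjOn F (Set.Icc (-2 : ℝ) 2) := by
  intro x hx y hy h
  rw [← nu_F h1 h2 hx, h, nu_F h1 h2 hy]

lemma F_image {ν νinv : ℝ → ℝ} (h1 : IsNu ν) (h2 : IsNuInv ν νinv)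
    : F '' (Set.Icc (-2 : ℝ) 2) = Set.Icc (-1 : ℝ) 1 := by
  ext k
  constructor
  · rintro ⟨x, hx, rfl⟩
    rw [F_eq h1 h2 hx]; exact (h2 x hx).1
  · intro hk
    refine ⟨ν k, h1.1 k hk, ?_⟩
    unfold F
    rw [h1.2.2.2 k hk]; ring

lemma cov {ν νinv : ℝ → ℝ} (h1 : IsNu ν) (h2 : IsNuInv ν νinv)
    (g : ℝ → ENNReal) :
    ∫⁻ k, g k ∂mu = ∫⁻ x in Set.Icc (-2 : ℝ) 2, ENNReal.ofReal (S x / Real.pi) * g (F x) := by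
  unfold mu
  rw [← F_image h1 h2, lintegral_image_eq_lintegral_abs_deriv_mul measurableSet_Icc
    (fun x _ => (F_deriv x).hasDerivWithinAt) (F_inj h1 h2)]
  refine lintegral_congr fun x => ?_
  rw [abs_of_nonneg (div_nonneg (S_nonneg x) Real.pi_pos.le)]

lemma push_le {ν νinv : ℝ → ℝ} (h1 : IsNu ν) (h2 : IsNuInv ν νinv)
    (H : ℝ → ENNReal) :
    ∫⁻ k, H (ν k) ∂mu ≤ ENNReal.ofReal (2 / Real.pi) * ∫⁻ x, H x := by
  rw [cov h1 h2, ← lintegral_const_mul' _ _ ENNReal.ofReal_ne_top]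
  refine le_trans ?_ (setLIntegral_le_lintegral (Set.Icc (-2 : ℝ) 2) _)
  refine setLIntegral_mono' measurableSet_Icc fun x hx => ?_
  rw [nu_F h1 h2 hx]
  gcongr
  exact S_le x

lemma full {ν νinv : ℝ → ℝ} (h1 : IsNu ν) (h2 : IsNuInv ν νinv)
    (G : ℝ → ENNReal) :
    ENNReal.ofReal (2 / Real.pi) * ∫⁻ w, ‖S w‖ₑ * G (F w) = 2 * ∫⁻ k, G k ∂mu := by
  have e : ∫⁻ w, ‖S w‖ₑ * G (F w) = ∫⁻ w in Set.Icc (-2 : ℝ) 2, ‖S w‖ₑ * G (F w) := by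
    symm
    apply setLIntegral_eq_of_support_subset
    intro w hw
    by_contra hn
    apply hw
    have : S w = 0 := S_zero (fun h => hn (abs_le.1 h))
    simp [this]
  rw [e, cov h1 h2, ← lintegral_const_mul' _ _ ENNReal.ofReal_ne_top,
    ← lintegral_const_mul' _ _ (by norm_num)]
  refine lintegral_congr fun w => ?_
  rw [← mul_assoc, ← mul_assoc, Real.enorm_eq_ofReal (S_nonneg w),
    ← ENNReal.ofReal_mul (by positivity)]
  congr 1
  have : (2 : ENNReal) = ENNReal.ofReal 2 := by simp
  rw [this, ← ENNReal.ofReal_mul (by positivity)]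
  congr 1
  ring

lemma K_add {ν νinv : ℝ → ℝ} (h1 : IsNu ν) (h2 : IsNuInv ν νinv)
    (G : ℝ → ENNReal) (c : ℝ) :
    ∫⁻ k, ‖S (ν k + c)‖ₑ * G (F (ν k + c)) ∂mu ≤ 2 * ∫⁻ k, G k ∂mu := by
  rw [← full h1 h2, ← lintegral_add_right_eq_self (fun w => ‖S w‖ₑ * G (F w)) c]
  exact push_le h1 h2 (fun x => ‖S (x + c)‖ₑ * G (F (x + c)))

lemma K_sub {ν νinv : ℝ → ℝ} (h1 : IsNu ν) (h2 : IsNuInv ν νinv)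
    (G : ℝ → ENNReal) (c : ℝ) :
    ∫⁻ k, ‖S (c - ν k)‖ₑ * G (F (c - ν k)) ∂mu ≤ 2 * ∫⁻ k, G k ∂mu := by
  rw [← full h1 h2, ← lintegral_sub_left_eq_self (fun w => ‖S w‖ₑ * G (F w)) c]
  exact push_le h1 h2 (fun x => ‖S (c - x)‖ₑ * G (F (c - x)))


/-- The resonance variable. -/
def W (ν : ℝ → ℝ) (q : ℝ × ℝ × ℝ) : ℝ := ν q.1 - ν q.2.1 + ν q.2.2

/-- The triple product measure. -/
noncomputable def mu3 : Measure (ℝ × ℝ × ℝ) := mu.prod (mu.prod mu)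

lemma meas1 {β : Type*} [MeasurableSpace β] {f : ℝ → β} (h : AEMeasurable f mu) :
    AEMeasurable (fun q : ℝ × ℝ × ℝ => f q.1) mu3 :=
  AEMeasurable.comp_fst h

lemma meas2 {β : Type*} [MeasurableSpace β] {f : ℝ → β} (h : AEMeasurable f mu) :
    AEMeasurable (fun q : ℝ × ℝ × ℝ => f q.2.1) mu3 :=
  AEMeasurable.comp_snd (f := fun p : ℝ × ℝ => f p.1) (AEMeasurable.comp_fst h)

lemma meas3 {β : Type*} [MeasurableSpace β] {f : ℝ → β} (h : AEMeasurable f mu) :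
    AEMeasurable (fun q : ℝ × ℝ × ℝ => f q.2.2) mu3 :=
  AEMeasurable.comp_snd (f := fun p : ℝ × ℝ => f p.2) (AEMeasurable.comp_snd h)

lemma slice_meas {g : ℝ × ℝ × ℝ → ENNReal} (hg : AEMeasurable g mu3) :
    ∀ᵐ k ∂mu, AEMeasurable (fun p => g (k, p)) (mu.prod mu) := by
  have h : ∀ᵐ q ∂(mu.prod (mu.prod mu)), g q = hg.mk g q := hg.ae_eq_mk
  filter_upwards [Measure.ae_ae_of_ae_prod h] with k hk
  exact ⟨fun p => hg.mk g (k, p), hg.measurable_mk.comp measurable_prodMk_left, hk⟩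

lemma W_meas {ν : ℝ → ℝ} (h1 : IsNu ν) : AEMeasurable (W ν) mu3 := by
  have h : AEMeasurable ν mu := h1.2.2.1.aemeasurable measurableSet_Icc
  exact ((meas1 h).sub (meas2 h)).add (meas3 h)


lemma SW_meas {ν νinv : ℝ → ℝ} (h1 : IsNu ν) (h2 : IsNuInv ν νinv)
    {c : ℝ → ℝ} (hc : AEMeasurable c mu) :
    AEMeasurable (fun q => S (W ν q) * c (F (W ν q))) mu3 := by
  have hW := W_meas h1
  refine ⟨fun q => S (hW.mk _ q) * hc.mk c (F (hW.mk _ q)), ?_, ?_⟩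
  · exact (S_cont.measurable.comp hW.measurable_mk).mul
      (hc.measurable_mk.comp (F_cont.measurable.comp hW.measurable_mk))
  obtain ⟨N, hN, hNm, hN0⟩ : ∃ N, {x | c x ≠ hc.mk c x} ⊆ N ∧ MeasurableSet N ∧ mu N = 0 :=
    exists_measurable_superset_of_null hc.ae_eq_mk
  have hnull : ∫⁻ q, ‖S (W ν q)‖ₑ * N.indicator 1 (F (W ν q)) ∂mu3 = 0 := by
    unfold mu3
    have hm : AEMeasurable (fun q => ‖S (W ν q)‖ₑ * N.indicator (1 : ℝ → ENNReal) (F (W ν q)))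
        mu3 := by
      refine AEMeasurable.mul ?_ ?_
      · exact (S_cont.measurable.comp_aemeasurable hW).enorm
      · exact ((measurable_one.indicator hNm).comp F_cont.measurable).comp_aemeasurable hW
    rw [← nonpos_iff_eq_zero]
    rw [lintegral_prod _ hm]
    have : ∀ k : ℝ, ∀ l : ℝ, ∫⁻ m, ‖S (W ν (k, l, m))‖ₑ *
        N.indicator (1 : ℝ → ENNReal) (F (W ν (k, l, m))) ∂mu = 0 := by
      intro k l
      have := K_add h1 h2 (N.indicator (1 : ℝ → ENNReal)) (ν k - ν l)
      rw [lintegral_indicator_one hNm, hN0, mul_zero, nonpos_iff_eq_zero] at this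
      simpa [W, add_comm] using this
    have h' : ∀ᵐ k ∂mu, ∫⁻ p, ‖S (W ν (k, p))‖ₑ *
        N.indicator (1 : ℝ → ENNReal) (F (W ν (k, p))) ∂(mu.prod mu) = 0 := by
      filter_upwards [slice_meas hm] with k hk
      rw [lintegral_prod _ hk]
      simp [this]
    rw [lintegral_congr_ae h']
    simp
  have hm : AEMeasurable (fun q => ‖S (W ν q)‖ₑ * N.indicator (1 : ℝ → ENNReal) (F (W ν q)))
      mu3 := by
    refine AEMeasurable.mul ?_ ?_
    · exact (S_cont.measurable.comp_aemeasurable hW).enorm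
    · exact ((measurable_one.indicator hNm).comp F_cont.measurable).comp_aemeasurable hW
  rw [lintegral_eq_zero_iff' hm] at hnull
  filter_upwards [hnull, hW.ae_eq_mk] with q hq hq2
  rw [← hq2]
  by_cases hS : S (W ν q) = 0
  · simp [hS]
  · have : F (W ν q) ∉ N := by
      intro hmem
      simp [hmem, hS] at hq
    have : c (F (W ν q)) = hc.mk c (F (W ν q)) := by
      by_contra hne
      exact this (hN hne)
    rw [this]


/-- A bounded trilinear form with values in `L¹`. -/
def TB (T : (ℝ → ℝ) → (ℝ → ℝ) → (ℝ → ℝ) → (ℝ × ℝ × ℝ → ℝ)) : Prop :=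
  ∀ a b c : ℝ → ℝ, Integrable a mu → Integrable b mu → Integrable c mu →
    Integrable (T a b c) mu3 ∧
      ∫ q, |T a b c q| ∂mu3 ≤ 2 * (∫ k, |a k| ∂mu) * (∫ k, |b k| ∂mu) * ∫ k, |c k| ∂mu

lemma TB_of {T : (ℝ → ℝ) → (ℝ → ℝ) → (ℝ → ℝ) → (ℝ × ℝ × ℝ → ℝ)}
    (h : ∀ a b c : ℝ → ℝ, Integrable a mu → Integrable b mu → Integrable c mu →
      AEMeasurable (T a b c) mu3 ∧
      ∫⁻ q, ‖T a b c q‖ₑ ∂mu3 ≤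
        2 * (∫⁻ k, ‖a k‖ₑ ∂mu) * (∫⁻ k, ‖b k‖ₑ ∂mu) * ∫⁻ k, ‖c k‖ₑ ∂mu) : TB T := by
  intro a b c ha hb hc
  obtain ⟨hm, hle⟩ := h a b c ha hb hc
  have fin : 2 * (∫⁻ k, ‖a k‖ₑ ∂mu) * (∫⁻ k, ‖b k‖ₑ ∂mu) * ∫⁻ k, ‖c k‖ₑ ∂mu ≠ ⊤ :=
    ENNReal.mul_ne_top (ENNReal.mul_ne_top (ENNReal.mul_ne_top (by norm_num)
      ha.hasFiniteIntegral.ne) hb.hasFiniteIntegral.ne) hc.hasFiniteIntegral.ne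
  refine ⟨⟨hm.aestronglyMeasurable, lt_of_le_of_lt hle fin.lt_top⟩, ?_⟩
  have key := ENNReal.toReal_mono fin hle
  simp only [ENNReal.toReal_mul] at key
  rw [← integral_norm_eq_lintegral_enorm hm.aestronglyMeasurable,
    ← integral_norm_eq_lintegral_enorm ha.aestronglyMeasurable,
    ← integral_norm_eq_lintegral_enorm hb.aestronglyMeasurable,
    ← integral_norm_eq_lintegral_enorm hc.aestronglyMeasurable] at key
  simpa [Real.norm_eq_abs] using key

lemma TB_diff {T : (ℝ → ℝ) → (ℝ → ℝ) → (ℝ → ℝ) → (ℝ × ℝ × ℝ → ℝ)} (hT : TB T)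
    (lin : ∀ r f : ℝ → ℝ, ∀ q, T r r r q - T f f f q =
      T (r - f) r r q + T f (r - f) r q + T f f (r - f) q)
    {r f : ℝ → ℝ} (hr : Integrable r mu) (hf : Integrable f mu) :
    ∫ q, |T r r r q - T f f f q| ∂mu3 ≤
      2 * ((∫ k, |r k| ∂mu) + ∫ k, |f k| ∂mu) ^ 2 * ∫ k, |r k - f k| ∂mu := by
  have hd := hr.sub hf
  obtain ⟨i1, b1⟩ := hT _ _ _ hd hr hr
  obtain ⟨i2, b2⟩ := hT _ _ _ hf hd hr
  obtain ⟨i3, b3⟩ := hT _ _ _ hf hf hd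
  have hA : 0 ≤ ∫ k, |r k| ∂mu := integral_nonneg fun _ => abs_nonneg _
  have hB : 0 ≤ ∫ k, |f k| ∂mu := integral_nonneg fun _ => abs_nonneg _
  have hD : 0 ≤ ∫ k, |r k - f k| ∂mu := integral_nonneg fun _ => abs_nonneg _
  have : ∫ q, |T r r r q - T f f f q| ∂mu3 ≤
      ∫ q, |T (r - f) r r q| + |T f (r - f) r q| + |T f f (r - f) q| ∂mu3 := by
    refine integral_mono_of_nonneg (Filter.Eventually.of_forall fun _ => abs_nonneg _)
      ((i1.abs.add i2.abs).add i3.abs) (Filter.Eventually.of_forall fun q => ?_)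
    simp only [lin r f q]
    exact abs_add_three _ _ _
  have e : ∫ q, |T (r - f) r r q| + |T f (r - f) r q| + |T f f (r - f) q| ∂mu3 =
      ∫ q, |T (r - f) r r q| ∂mu3 + ∫ q, |T f (r - f) r q| ∂mu3 +
        ∫ q, |T f f (r - f) q| ∂mu3 :=
    (integral_add (i1.abs.add i2.abs) i3.abs).trans
      (congrArg (· + _) (integral_add i1.abs i2.abs))
  rw [e] at this
  simp only [Pi.sub_apply] at b1 b2 b3
  generalize (∫ k, |r k| ∂mu) = A at *
  generalize (∫ k, |f k| ∂mu) = B at *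
  generalize (∫ k, |r k - f k| ∂mu) = D at *
  have : 0 ≤ A * B * D := by positivity
  nlinarith

/-- Gain term. -/
noncomputable def T1 (ν : ℝ → ℝ) (a b c : ℝ → ℝ) (q : ℝ × ℝ × ℝ) : ℝ :=
  S (W ν q) * (a q.2.1 * b q.2.2 * c (F (W ν q)))
/-- Second term. -/
noncomputable def T2 (ν : ℝ → ℝ) (a b c : ℝ → ℝ) (q : ℝ × ℝ × ℝ) : ℝ :=
  S (W ν q) * (a q.1 * b q.2.2 * c (F (W ν q)))
/-- Third term. -/
noncomputable def T3 (ν : ℝ → ℝ) (a b c : ℝ → ℝ) (q : ℝ × ℝ × ℝ) : ℝ :=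
  S (W ν q) * (a q.1 * b q.2.1 * c (F (W ν q)))
/-- Fourth term. -/
noncomputable def T4 (ν : ℝ → ℝ) (a b c : ℝ → ℝ) (q : ℝ × ℝ × ℝ) : ℝ :=
  S (W ν q) * (a q.1 * b q.2.1 * c q.2.2)

/-- Iterated form of the two outer integrals. -/
lemma outer {a b : ℝ → ℝ} (ha : Integrable a mu) (hb : Integrable b mu) (C : ENNReal)
    (G : ℝ → ℝ → ENNReal)
    (hG : ∀ x y, G x y ≤ ‖a x‖ₑ * ‖b y‖ₑ * (2 * C)) :
    ∫⁻ x, ∫⁻ y, G x y ∂mu ∂mu ≤ 2 * (∫⁻ k, ‖a k‖ₑ ∂mu) * (∫⁻ k, ‖b k‖ₑ ∂mu) * C := by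
  calc ∫⁻ x, ∫⁻ y, G x y ∂mu ∂mu
      ≤ ∫⁻ x, ∫⁻ y, ‖a x‖ₑ * ‖b y‖ₑ * (2 * C) ∂mu ∂mu :=
        lintegral_mono fun x => lintegral_mono fun y => hG x y
    _ = 2 * (∫⁻ k, ‖a k‖ₑ ∂mu) * (∫⁻ k, ‖b k‖ₑ ∂mu) * C := by
        have e : ∀ x, ∫⁻ y, ‖a x‖ₑ * ‖b y‖ₑ * (2 * C) ∂mu
            = ‖a x‖ₑ * ((∫⁻ y, ‖b y‖ₑ ∂mu) * (2 * C)) := by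
          intro x
          rw [lintegral_mul_const'' _ (hb.aemeasurable.enorm.const_mul _),
            lintegral_const_mul' _ _ enorm_ne_top, mul_assoc]
        simp_rw [e]
        rw [lintegral_mul_const'' _ ha.aemeasurable.enorm]
        ring

/-- Tonelli, order `k, l, m`. -/
lemma ton {g : ℝ × ℝ × ℝ → ENNReal} (hg : AEMeasurable g mu3) :
    ∫⁻ q, g q ∂mu3 = ∫⁻ k, ∫⁻ l, ∫⁻ m, g (k, l, m) ∂mu ∂mu ∂mu := by
  unfold mu3
  rw [lintegral_prod _ hg]
  refine lintegral_congr_ae ?_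
  filter_upwards [slice_meas hg] with k hk
  rw [lintegral_prod _ hk]

lemma ton2 {g : ℝ × ℝ × ℝ → ENNReal} (hg : AEMeasurable g mu3) :
    ∫⁻ q, g q ∂mu3 = ∫⁻ k, ∫⁻ m, ∫⁻ l, g (k, l, m) ∂mu ∂mu ∂mu := by
  unfold mu3
  rw [lintegral_prod _ hg]
  refine lintegral_congr_ae ?_
  filter_upwards [slice_meas hg] with k hk
  rw [lintegral_prod_symm _ hk]

lemma ton1 {g : ℝ × ℝ × ℝ → ENNReal} (hg : AEMeasurable g mu3) :
    ∫⁻ q, g q ∂mu3 = ∫⁻ l, ∫⁻ m, ∫⁻ k, g (k, l, m) ∂mu ∂mu ∂mu := by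
  unfold mu3
  rw [lintegral_prod_symm _ hg]
  rw [lintegral_prod]
  exact hg.lintegral_prod_left'


lemma TB1 {ν νinv : ℝ → ℝ} (h1 : IsNu ν) (h2 : IsNuInv ν νinv)
    : TB (T1 ν) := by
  refine TB_of fun a b c ha hb hc => ?_
  have hm : AEMeasurable (T1 ν a b c) mu3 := by
    have := ((meas2 ha.aemeasurable).mul (meas3 hb.aemeasurable)).mul
      (SW_meas h1 h2 hc.aemeasurable)
    refine this.congr (Filter.Eventually.of_forall fun q => ?_)
    simp only [T1, Pi.mul_apply]; ring
  refine ⟨hm, ?_⟩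
  rw [ton1 hm.enorm]
  refine outer ha hb _ _ fun x y => ?_
  have e : ∀ k, ‖T1 ν a b c (k, x, y)‖ₑ = ‖a x‖ₑ * ‖b y‖ₑ *
      (‖S (ν k + (ν y - ν x))‖ₑ * ‖c (F (ν k + (ν y - ν x)))‖ₑ) := by
    intro k
    have : W ν (k, x, y) = ν k + (ν y - ν x) := by unfold W; ring
    simp only [T1, this, enorm_mul]; ring
  simp_rw [e]
  rw [lintegral_const_mul' _ _ (ENNReal.mul_ne_top enorm_ne_top enorm_ne_top)]
  gcongr
  exact K_add h1 h2 (fun x => ‖c x‖ₑ) _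

lemma TB2 {ν νinv : ℝ → ℝ} (h1 : IsNu ν) (h2 : IsNuInv ν νinv)
    : TB (T2 ν) := by
  refine TB_of fun a b c ha hb hc => ?_
  have hm : AEMeasurable (T2 ν a b c) mu3 := by
    have := ((meas1 ha.aemeasurable).mul (meas3 hb.aemeasurable)).mul
      (SW_meas h1 h2 hc.aemeasurable)
    refine this.congr (Filter.Eventually.of_forall fun q => ?_)
    simp only [T2, Pi.mul_apply]; ring
  refine ⟨hm, ?_⟩
  rw [ton2 hm.enorm]
  refine outer ha hb _ _ fun x y => ?_
  have e : ∀ l, ‖T2 ν a b c (x, l, y)‖ₑ = ‖a x‖ₑ * ‖b y‖ₑ *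
      (‖S ((ν x + ν y) - ν l)‖ₑ * ‖c (F ((ν x + ν y) - ν l))‖ₑ) := by
    intro l
    have : W ν (x, l, y) = (ν x + ν y) - ν l := by unfold W; ring
    simp only [T2, this, enorm_mul]; ring
  simp_rw [e]
  rw [lintegral_const_mul' _ _ (ENNReal.mul_ne_top enorm_ne_top enorm_ne_top)]
  gcongr
  exact K_sub h1 h2 (fun x => ‖c x‖ₑ) _

lemma TB3 {ν νinv : ℝ → ℝ} (h1 : IsNu ν) (h2 : IsNuInv ν νinv)
    : TB (T3 ν) := by
  refine TB_of fun a b c ha hb hc => ?_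
  have hm : AEMeasurable (T3 ν a b c) mu3 := by
    have := ((meas1 ha.aemeasurable).mul (meas2 hb.aemeasurable)).mul
      (SW_meas h1 h2 hc.aemeasurable)
    refine this.congr (Filter.Eventually.of_forall fun q => ?_)
    simp only [T3, Pi.mul_apply]; ring
  refine ⟨hm, ?_⟩
  rw [ton hm.enorm]
  refine outer ha hb _ _ fun x y => ?_
  have e : ∀ m, ‖T3 ν a b c (x, y, m)‖ₑ = ‖a x‖ₑ * ‖b y‖ₑ *
      (‖S (ν m + (ν x - ν y))‖ₑ * ‖c (F (ν m + (ν x - ν y)))‖ₑ) := by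
    intro m
    have : W ν (x, y, m) = ν m + (ν x - ν y) := by unfold W; ring
    simp only [T3, this, enorm_mul]; ring
  simp_rw [e]
  rw [lintegral_const_mul' _ _ (ENNReal.mul_ne_top enorm_ne_top enorm_ne_top)]
  gcongr
  exact K_add h1 h2 (fun x => ‖c x‖ₑ) _

lemma TB4 {ν : ℝ → ℝ} (h1 : IsNu ν)
    : TB (T4 ν) := by
  refine TB_of fun a b c ha hb hc => ?_
  have hm : AEMeasurable (T4 ν a b c) mu3 :=
    (S_cont.measurable.comp_aemeasurable (W_meas h1)).mul
      (((meas1 ha.aemeasurable).mul (meas2 hb.aemeasurable)).mul (meas3 hc.aemeasurable))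
  refine ⟨hm, ?_⟩
  rw [ton hm.enorm]
  refine outer ha hb _ _ fun x y => ?_
  have e : ∀ m, ‖T4 ν a b c (x, y, m)‖ₑ ≤ ‖a x‖ₑ * ‖b y‖ₑ * 2 * ‖c m‖ₑ := by
    intro m
    have : ‖S (W ν (x, y, m))‖ₑ ≤ 2 := by
      rw [Real.enorm_eq_ofReal (S_nonneg _)]
      calc _ ≤ ENNReal.ofReal 2 := ENNReal.ofReal_le_ofReal (S_le _)
        _ = 2 := by simp
    simp only [T4, enorm_mul]
    calc _ ≤ 2 * (‖a x‖ₑ * ‖b y‖ₑ * ‖c m‖ₑ) := by gcongr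
      _ = _ := by ring
  refine (lintegral_mono e).trans ?_
  rw [lintegral_const_mul' _ _ (ENNReal.mul_ne_top
    (ENNReal.mul_ne_top enorm_ne_top enorm_ne_top) (by norm_num)), mul_assoc]


/-- The full integrand. -/
noncomputable def Q (ν r : ℝ → ℝ) (q : ℝ × ℝ × ℝ) : ℝ :=
  T1 ν r r r q - T2 ν r r r q + T3 ν r r r q - T4 ν r r r q


lemma collision_eq {ν νinv : ℝ → ℝ} (h1 : IsNu ν) (h2 : IsNuInv ν νinv)
    (r : ℝ → ℝ) (k : ℝ) :
    collision ν νinv r k = (1 / 2) * ∫ p, Q ν r (k, p) ∂(mu.prod mu) := by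
  unfold collision mu
  rw [Measure.prod_restrict, ← Measure.volume_eq_prod]
  congr 1
  refine integral_congr_ae (Filter.Eventually.of_forall fun p => ?_)
  simp only [Q, T1, T2, T3, T4, W]
  split_ifs with h
  · rw [F_eq h1 h2 (abs_le.1 h)]
    simp only [S]; ring
  · rw [S_zero h]; ring

lemma Q_int {ν νinv : ℝ → ℝ} (h1 : IsNu ν) (h2 : IsNuInv ν νinv)
    {r : ℝ → ℝ} (hr : Integrable r mu) : Integrable (Q ν r) mu3 :=
  (((TB1 h1 h2 _ _ _ hr hr hr).1.sub (TB2 h1 h2 _ _ _ hr hr hr).1).add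
    (TB3 h1 h2 _ _ _ hr hr hr).1).sub (TB4 h1 _ _ _ hr hr hr).1

lemma Q_diff {ν νinv : ℝ → ℝ} (h1 : IsNu ν) (h2 : IsNuInv ν νinv)
    {r f : ℝ → ℝ} (hr : Integrable r mu) (hf : Integrable f mu) :
    ∫ q, |Q ν r q - Q ν f q| ∂mu3 ≤
      8 * ((∫ k, |r k| ∂mu) + ∫ k, |f k| ∂mu) ^ 2 * ∫ k, |r k - f k| ∂mu := by
  have d1 := TB_diff (TB1 h1 h2) (by intro r f q; simp only [T1, Pi.sub_apply]; ring) hr hf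
  have d2 := TB_diff (TB2 h1 h2) (by intro r f q; simp only [T2, Pi.sub_apply]; ring) hr hf
  have d3 := TB_diff (TB3 h1 h2) (by intro r f q; simp only [T3, Pi.sub_apply]; ring) hr hf
  have d4 := TB_diff (TB4 h1) (by intro r f q; simp only [T4, Pi.sub_apply]; ring) hr hf
  have i1 := ((TB1 h1 h2 _ _ _ hr hr hr).1.sub (TB1 h1 h2 _ _ _ hf hf hf).1).abs
  have i2 := ((TB2 h1 h2 _ _ _ hr hr hr).1.sub (TB2 h1 h2 _ _ _ hf hf hf).1).abs
  have i3 := ((TB3 h1 h2 _ _ _ hr hr hr).1.sub (TB3 h1 h2 _ _ _ hf hf hf).1).abs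
  have i4 := ((TB4 h1 _ _ _ hr hr hr).1.sub (TB4 h1 _ _ _ hf hf hf).1).abs
  have : ∫ q, |Q ν r q - Q ν f q| ∂mu3 ≤
      ∫ q, |T1 ν r r r q - T1 ν f f f q| + |T2 ν r r r q - T2 ν f f f q| +
        |T3 ν r r r q - T3 ν f f f q| + |T4 ν r r r q - T4 ν f f f q| ∂mu3 := by
    refine integral_mono_of_nonneg (Filter.Eventually.of_forall fun _ => abs_nonneg _)
      (((i1.add i2).add i3).add i4) (Filter.Eventually.of_forall fun q => ?_)
    simp only [Q]
    generalize T1 ν r r r q = x1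
    generalize T2 ν r r r q = x2
    generalize T3 ν r r r q = x3
    generalize T4 ν r r r q = x4
    rw [abs_le]
    constructor <;>
    linarith [le_abs_self (x1 - T1 ν f f f q), neg_abs_le (x1 - T1 ν f f f q),
      le_abs_self (x2 - T2 ν f f f q), neg_abs_le (x2 - T2 ν f f f q),
      le_abs_self (x3 - T3 ν f f f q), neg_abs_le (x3 - T3 ν f f f q),
      le_abs_self (x4 - T4 ν f f f q), neg_abs_le (x4 - T4 ν f f f q)]
  have e : ∫ q, |T1 ν r r r q - T1 ν f f f q| + |T2 ν r r r q - T2 ν f f f q| +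
        |T3 ν r r r q - T3 ν f f f q| + |T4 ν r r r q - T4 ν f f f q| ∂mu3 =
      ∫ q, |T1 ν r r r q - T1 ν f f f q| ∂mu3 + ∫ q, |T2 ν r r r q - T2 ν f f f q| ∂mu3 +
      ∫ q, |T3 ν r r r q - T3 ν f f f q| ∂mu3 + ∫ q, |T4 ν r r r q - T4 ν f f f q| ∂mu3 := by
    exact (integral_add ((i1.add i2).add i3) i4).trans (congrArg (· + _)
      ((integral_add (i1.add i2) i3).trans (congrArg (· + _) (integral_add i1 i2))))
  linarith

lemma final {ν νinv : ℝ → ℝ} (h1 : IsNu ν) (h2 : IsNuInv ν νinv)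
    {r f : ℝ → ℝ} (hr : Integrable r mu) (hf : Integrable f mu) :
    ∫ k, |collision ν νinv r k - collision ν νinv f k| ∂mu ≤
      4 * ((∫ k, |r k| ∂mu) + ∫ k, |f k| ∂mu) ^ 2 * ∫ k, |r k - f k| ∂mu := by
  have ir := Q_int h1 h2 hr
  have jf := Q_int h1 h2 hf
  have d := Q_diff h1 h2 hr hf
  have isub : Integrable (fun q => |Q ν r q - Q ν f q|) mu3 := (ir.sub jf).abs
  unfold mu3 at ir jf d isub
  rw [integral_prod _ isub] at d
  have : ∫ k, |collision ν νinv r k - collision ν νinv f k| ∂mu ≤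
      ∫ k, (1 / 2) * ∫ p, |Q ν r (k, p) - Q ν f (k, p)| ∂(mu.prod mu) ∂mu := by
    refine integral_mono_of_nonneg (Filter.Eventually.of_forall fun _ => abs_nonneg _)
      (isub.integral_prod_left.const_mul _) ?_
    filter_upwards [ir.prod_right_ae, jf.prod_right_ae] with k hk1 hk2
    rw [collision_eq h1 h2, collision_eq h1 h2, ← mul_sub, ← integral_sub hk1 hk2, abs_mul,
      abs_of_pos (by norm_num : (0 : ℝ) < 1 / 2)]
    gcongr
    exact abs_integral_le_integral_abs
  rw [integral_const_mul] at this
  linarith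


end ScAux

/-- The collision operator is locally Lipschitz on `L¹[-1,1]`:
`‖𝐂[ρ] − 𝐂[φ]‖_{L¹} ≤ C₀ (‖ρ‖_{L¹} + ‖φ‖_{L¹})² ‖ρ − φ‖_{L¹}`. -/
theorem stmt1 :
    ∃ C₀ > (0 : ℝ), ∀ ν νinv : ℝ → ℝ, IsNu ν → IsNuInv ν νinv →
      ∀ ρ φ : ℝ → ℝ, IntegrableOn ρ (Set.Icc (-1 : ℝ) 1) →
        IntegrableOn φ (Set.Icc (-1 : ℝ) 1) →
          (∫ k in Set.Icc (-1 : ℝ) 1, |collision ν νinv ρ k - collision ν νinv φ k|) ≤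
            C₀ * ((∫ k in Set.Icc (-1 : ℝ) 1, |ρ k|) + ∫ k in Set.Icc (-1 : ℝ) 1, |φ k|) ^ 2 *
              ∫ k in Set.Icc (-1 : ℝ) 1, |ρ k - φ k| := by
  refine ⟨4, by norm_num, fun ν νinv h1 h2 ρ φ hρ hφ => ?_⟩
  exact ScAux.final h1 h2 hρ hφ
end

section
/- Fix integers p ≥ 0 and q ≥ 0, not both zero. Let Ψ be Haar-distributed on U(d) and let k, l, m, n ∈ {1,…,d} be pairwise distinct. Then: (i) if p ≠ q, E[ γ(k,l,m,n)^p · conj(γ(k,l,m,n))^q ] = 0; (ii) there is a constant C_p (independent of d and of the choice of distinct indices) such that | E[ |γ(k,l,m,n)|^{2p} ] − p! · d^{−3p} | ≤ C_p · d^{−3p−1} for all sufficiently large d. Both statements also hold with γ(k,l,m,n) replaced by γ(k,k,m,n) where k, m, n are pairwise distinct. -/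
open MeasureTheory

/-- The centered fourth-order eigenvector observable
`γ(k,ℓ,m,n) = ∑_j conj(ψ_{jk}) ψ_{jℓ} conj(ψ_{jm}) ψ_{jn} − (1/d)1_{k=ℓ,m=n} − (1/d)1_{k=n,ℓ=m}`. -/
noncomputable def gam {d : ℕ} (Ψ : Matrix (Fin d) (Fin d) ℂ) (k l m n : Fin d) : ℂ :=
  (∑ j, (starRingEnd ℂ) (Ψ j k) * Ψ j l * (starRingEnd ℂ) (Ψ j m) * Ψ j n) -
    (1 / (d : ℂ)) * (if k = l ∧ m = n then 1 else 0) -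
    (1 / (d : ℂ)) * (if k = n ∧ l = m then 1 else 0)

open MeasureTheory

section Combinatorics

open Finset

theorem card_piAntidiag_univ (ι : Type) [Fintype ι] [DecidableEq ι] (p : ℕ) :
    (p.factorial) * (piAntidiag (univ : Finset ι) p).card = (Fintype.card ι).ascFactorial p := by
  rw [← map_sym_eq_piAntidiag, card_map, sym_univ, card_univ, Sym.card_sym_eq_choose,
    Nat.ascFactorial_eq_factorial_mul_choose']

theorem root_sum (p : ℕ) (ζ : ℂ) (hζ : IsPrimitiveRoot ζ (p + 1)) (a b : ℕ) (ha : a ≤ p)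
    (hb : b ≤ p) :
    ∑ c : Fin (p + 1), (ζ ^ (c : ℕ)) ^ a * (starRingEnd ℂ) ((ζ ^ (c : ℕ)) ^ b) =
      if a = b then ((p : ℂ) + 1) else 0 := by
  have hn : ‖ζ‖ = 1 := hζ.norm'_eq_one (by omega)
  have hc : (starRingEnd ℂ) ζ * ζ = 1 := by
    rw [Complex.conj_mul', hn]; norm_num
  have hz : ζ ≠ 0 := by intro h; simp [h] at hn
  have hci : (starRingEnd ℂ) ζ = ζ⁻¹ := eq_inv_of_mul_eq_one_left hc
  set x : ℂ := ζ ^ a * (ζ⁻¹) ^ b with hx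
  have h1 : ∀ c : Fin (p + 1), (ζ ^ (c : ℕ)) ^ a * (starRingEnd ℂ) ((ζ ^ (c : ℕ)) ^ b)
      = x ^ (c : ℕ) := by
    intro c
    rw [map_pow, map_pow, hci, hx, mul_pow]
    ring
  simp_rw [h1]
  rw [Fin.sum_univ_eq_sum_range (fun c => x ^ c)]
  split_ifs with hab
  · have : x = 1 := by
      rw [hx, hab, ← mul_pow, mul_inv_cancel₀ hz, one_pow]
    simp [this]
  · have hx1 : x ≠ 1 := by
      intro h
      apply hab
      have : ζ ^ a = ζ ^ b := by
        rw [hx, inv_pow, mul_inv_eq_one₀ (pow_ne_zero _ hz)] at h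
        exact h
      exact hζ.pow_inj (by omega) (by omega) this
    rw [geom_sum_eq hx1]
    have : x ^ (p + 1) = 1 := by
      rw [hx, mul_pow, ← pow_mul, ← pow_mul, mul_comm a, mul_comm b, pow_mul, pow_mul,
        inv_pow, hζ.pow_eq_one]
      simp
    rw [this]; simp

theorem phase_avg {ι : Type} [Fintype ι] [DecidableEq ι] (p : ℕ) (ζ : ℂ)
    (hζ : IsPrimitiveRoot ζ (p + 1)) (u : ι → ℂ) :
    ∑ y : ι → Fin (p + 1), ‖∑ j, ζ ^ (y j : ℕ) * u j‖ ^ (2 * p) =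
      ((p : ℝ) + 1) ^ (Fintype.card ι) * ∑ α ∈ piAntidiag (univ : Finset ι) p,
        (Nat.multinomial univ α : ℝ) ^ 2 * ∏ j, (‖u j‖ ^ 2) ^ (α j) := by
  have hcast : ∀ x : ℂ, (((‖x‖ ^ (2 * p) : ℝ)) : ℂ) = x ^ p * (starRingEnd ℂ) (x ^ p) := by
    intro x
    rw [Complex.mul_conj', norm_pow]
    push_cast
    ring
  apply Complex.ofReal_injective
  push_cast
  have e1 : ∀ y : ι → Fin (p + 1), ((‖∑ j, ζ ^ (y j : ℕ) * u j‖ : ℝ) : ℂ) ^ (2 * p)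
      = ∑ α ∈ piAntidiag (univ : Finset ι) p, ∑ β ∈ piAntidiag (univ : Finset ι) p,
        ((Nat.multinomial univ α : ℂ) * (Nat.multinomial univ β : ℂ) *
          (∏ j, u j ^ α j * (starRingEnd ℂ) (u j ^ β j))) *
          ∏ j, ((ζ ^ (y j : ℕ)) ^ α j * (starRingEnd ℂ) ((ζ ^ (y j : ℕ)) ^ β j)) := by
    intro y
    have := hcast (∑ j, ζ ^ (y j : ℕ) * u j)
    push_cast at this
    rw [this, sum_pow_eq_sum_piAntidiag, map_sum, sum_mul_sum]
    apply sum_congr rfl; intro α _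
    apply sum_congr rfl; intro β _
    simp only [map_mul, map_prod, map_natCast, mul_pow, prod_mul_distrib]
    ring
  simp_rw [e1]
  rw [sum_comm]
  rw [mul_sum]
  apply sum_congr rfl; intro α hα
  rw [sum_comm]
  have hle : ∀ γ ∈ piAntidiag (univ : Finset ι) p, ∀ j, γ j ≤ p := by
    intro γ hγ j
    rw [mem_piAntidiag] at hγ
    rw [← hγ.1]
    exact single_le_sum (f := γ) (fun _ _ => Nat.zero_le _) (mem_univ j)
  have e2 : ∀ β ∈ piAntidiag (univ : Finset ι) p, ∑ y : ι → Fin (p + 1),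
      ((Nat.multinomial univ α : ℂ) * (Nat.multinomial univ β : ℂ) *
          (∏ j, u j ^ α j * (starRingEnd ℂ) (u j ^ β j))) *
          ∏ j, ((ζ ^ (y j : ℕ)) ^ α j * (starRingEnd ℂ) ((ζ ^ (y j : ℕ)) ^ β j)) =
      if α = β then ((Nat.multinomial univ α : ℂ) * (Nat.multinomial univ β : ℂ) *
          (∏ j, u j ^ α j * (starRingEnd ℂ) (u j ^ β j))) * ((p : ℂ) + 1) ^ (Fintype.card ι)
          else 0 := by
    intro β hβ
    rw [← mul_sum]
    have := (Finset.prod_univ_sum (fun _ : ι => (univ : Finset (Fin (p + 1))))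
      (fun j c => (ζ ^ (c : ℕ)) ^ α j * (starRingEnd ℂ) ((ζ ^ (c : ℕ)) ^ β j)))
    rw [Fintype.piFinset_univ] at this
    rw [← this]
    have e3 : ∀ j, ∑ c : Fin (p + 1), (ζ ^ (c : ℕ)) ^ α j * (starRingEnd ℂ) ((ζ ^ (c : ℕ)) ^ β j)
        = if α j = β j then ((p : ℂ) + 1) else 0 := fun j =>
      root_sum p ζ hζ _ _ (hle α hα j) (hle β hβ j)
    simp_rw [e3]
    split_ifs with h
    · subst h; simp
    · have : ∃ j, α j ≠ β j := by
        by_contra hcon; push Not at hcon; exact h (funext hcon)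
      obtain ⟨j, hj⟩ := this
      have h0 : (∏ j, if α j = β j then ((p : ℂ) + 1) else 0) = 0 :=
        prod_eq_zero (mem_univ j) (by simp [hj])
      rw [h0, mul_zero]
  rw [sum_congr rfl e2]
  rw [sum_ite_eq, if_pos hα]
  have : ∀ j, u j ^ α j * (starRingEnd ℂ) (u j ^ α j) = ((‖u j‖ : ℂ) ^ 2) ^ α j := by
    intro j
    rw [Complex.mul_conj', norm_pow]; push_cast; ring
  simp_rw [this]
  ring

theorem coeff_compare {ι : Type} [Fintype ι] [DecidableEq ι] (p : ℕ) (A B : (ι → ℕ) → ℝ)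
    (h : ∀ x : ι → ℝ, ∑ α ∈ piAntidiag (univ : Finset ι) p, A α * ∏ j, (x j ^ 2) ^ α j =
      ∑ α ∈ piAntidiag (univ : Finset ι) p, B α * ∏ j, (x j ^ 2) ^ α j) :
    ∀ α ∈ piAntidiag (univ : Finset ι) p, A α = B α := by
  intro β hβ
  let Q : (ι → ℕ) → ((ι → ℕ) → ℝ) → MvPolynomial ι ℝ := fun α A =>
    MvPolynomial.monomial (Finsupp.equivFunOnFinite.symm (2 • α)) (A α)
  have hQ : ∑ α ∈ piAntidiag (univ : Finset ι) p, Q α A =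
      ∑ α ∈ piAntidiag (univ : Finset ι) p, Q α B := by
    apply MvPolynomial.funext
    intro x
    have e : ∀ α A, MvPolynomial.eval x (Q α A) = A α * ∏ j, (x j ^ 2) ^ α j := by
      intro α A
      simp only [Q, MvPolynomial.eval_monomial]
      congr 1
      rw [Finsupp.prod_fintype]
      · apply prod_congr rfl; intro j _
        simp [pow_mul]
      · simp
    simp only [map_sum, e]
    exact h x
  have hc := congrArg (MvPolynomial.coeff (Finsupp.equivFunOnFinite.symm (2 • β))) hQ
  have e : ∀ A : (ι → ℕ) → ℝ, MvPolynomial.coeff (Finsupp.equivFunOnFinite.symm (2 • β))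
      (∑ α ∈ piAntidiag (univ : Finset ι) p, Q α A) = A β := by
    intro A
    simp only [Q, MvPolynomial.coeff_sum, MvPolynomial.coeff_monomial]
    rw [sum_eq_single β]
    · simp
    · intro α _ hne
      rw [if_neg]
      intro heq
      apply hne
      have := Finsupp.equivFunOnFinite.symm.injective heq
      funext j
      have := congrFun this j
      simpa using this
    · intro hn; exact absurd hβ hn
  rw [e, e] at hc
  exact hc

/-- multi-indices with some repeated entry -/
def nonSqfree (ι : Type) [Fintype ι] [DecidableEq ι] (p : ℕ) : Finset (ι → ℕ) :=
  (piAntidiag (univ : Finset ι) p).filter (fun α => ¬ ∀ j, α j ≤ 1)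

def sqfreeIdx (ι : Type) [Fintype ι] [DecidableEq ι] (p : ℕ) : Finset (ι → ℕ) :=
  (piAntidiag (univ : Finset ι) p).filter (fun α => ∀ j, α j ≤ 1)

theorem nonSqfree_subset {ι : Type} [Fintype ι] [DecidableEq ι] {p : ℕ} {α : ι → ℕ}
    (h : α ∈ nonSqfree ι p) : α ∈ piAntidiag (univ : Finset ι) p := (mem_filter.1 h).1

theorem sqfreeIdx_subset {ι : Type} [Fintype ι] [DecidableEq ι] {p : ℕ} {α : ι → ℕ}
    (h : α ∈ sqfreeIdx ι p) : α ∈ piAntidiag (univ : Finset ι) p := (mem_filter.1 h).1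

theorem multinomial_sqfree {ι : Type} [Fintype ι] [DecidableEq ι] {p : ℕ} {α : ι → ℕ}
    (hα : α ∈ sqfreeIdx ι p) : Nat.multinomial univ α = p.factorial := by
  simp only [sqfreeIdx, mem_filter, mem_piAntidiag] at hα
  have := Nat.multinomial_spec (univ : Finset ι) α
  rw [hα.1.1, prod_eq_one, one_mul] at this
  · exact this
  · intro i _
    have := hα.2 i
    interval_cases α i <;> rfl

theorem multinomial_le {ι : Type} [Fintype ι] [DecidableEq ι] {p : ℕ} {α : ι → ℕ}
    (hα : α ∈ piAntidiag (univ : Finset ι) p) : Nat.multinomial univ α ≤ p.factorial := by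
  rw [mem_piAntidiag] at hα
  have := Nat.multinomial_spec (univ : Finset ι) α
  rw [hα.1] at this
  rw [← this]
  exact Nat.le_mul_of_pos_left _ (prod_pos fun i _ => Nat.factorial_pos _)

theorem card_sqfree (ι : Type) [Fintype ι] [DecidableEq ι] (p : ℕ) :
    (sqfreeIdx ι p).card = (Fintype.card ι).choose p := by
  rw [← card_univ, ← card_powersetCard]
  symm
  apply card_bij' (fun (s : Finset ι) _ => fun j => if j ∈ s then 1 else 0)
    (fun (α : ι → ℕ) _ => univ.filter (fun j => α j = 1))
  · intro s hs
    rw [mem_powersetCard] at hs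
    simp only [sqfreeIdx, mem_filter, mem_piAntidiag]
    refine ⟨⟨by simp [hs.2], by simp⟩, fun j => by split_ifs <;> simp⟩
  · intro α hα
    simp only [sqfreeIdx, mem_filter, mem_piAntidiag] at hα
    rw [mem_powersetCard]
    refine ⟨subset_univ _, ?_⟩
    rw [card_filter, ← hα.1.1]
    apply sum_congr rfl; intro j _
    have := hα.2 j
    interval_cases α j <;> simp
  · intro s hs
    ext j; simp
  · intro α hα
    simp only [sqfreeIdx, mem_filter, mem_piAntidiag] at hα
    funext j
    have := hα.2 j
    simp only [mem_filter, mem_univ, true_and]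
    interval_cases α j <;> simp

theorem card_nonSqfree (ι : Type) [Fintype ι] [DecidableEq ι] (p : ℕ) :
    p.factorial * (nonSqfree ι p).card + (Fintype.card ι).descFactorial p =
      (Fintype.card ι).ascFactorial p := by
  rw [← card_piAntidiag_univ, Nat.descFactorial_eq_factorial_mul_choose, ← card_sqfree,
    ← mul_add]
  congr 1
  rw [nonSqfree, sqfreeIdx, add_comm]
  exact card_filter_add_card_filter_not _

theorem sum_split {ι : Type} [Fintype ι] [DecidableEq ι] (p : ℕ) (f : (ι → ℕ) → ℝ) :
    ∑ α ∈ piAntidiag (univ : Finset ι) p, f α =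
      ∑ α ∈ sqfreeIdx ι p, f α + ∑ α ∈ nonSqfree ι p, f α := by
  rw [nonSqfree, sqfreeIdx, sum_filter_add_sum_filter_not]

theorem pow_sum_le {ι : Type} [Fintype ι] [DecidableEq ι] (p : ℕ) (t : ι → ℝ)
    (ht : ∀ j, 0 ≤ t j) :
    p.factorial * (∑ j, t j) ^ p ≤
      ∑ α ∈ piAntidiag (univ : Finset ι) p, (Nat.multinomial univ α : ℝ) ^ 2 * ∏ j, t j ^ α j
      + (p.factorial : ℝ) ^ 2 * ∑ α ∈ nonSqfree ι p, ∏ j, t j ^ α j := by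
  have hpos : ∀ α : ι → ℕ, 0 ≤ ∏ j, t j ^ α j := fun α =>
    prod_nonneg fun j _ => pow_nonneg (ht j) _
  rw [sum_pow_eq_sum_piAntidiag, sum_split, sum_split, mul_add, mul_sum, mul_sum, mul_sum]
  have h1 : ∑ α ∈ sqfreeIdx ι p, (p.factorial : ℝ) * ((Nat.multinomial univ α : ℝ) * ∏ j, t j ^ α j)
      = ∑ α ∈ sqfreeIdx ι p, (Nat.multinomial univ α : ℝ) ^ 2 * ∏ j, t j ^ α j := by
    apply sum_congr rfl; intro α hα
    rw [multinomial_sqfree hα]; ring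
  rw [h1]
  have h2 : ∑ α ∈ nonSqfree ι p, (p.factorial : ℝ) * ((Nat.multinomial univ α : ℝ) * ∏ j, t j ^ α j)
      ≤ ∑ α ∈ nonSqfree ι p, (p.factorial : ℝ) ^ 2 * ∏ j, t j ^ α j := by
    apply sum_le_sum; intro α hα
    have : (Nat.multinomial univ α : ℝ) ≤ p.factorial := by
      exact_mod_cast multinomial_le (mem_filter.1 hα).1
    rw [sq, mul_assoc]
    gcongr
    exact hpos α
  have h3 : 0 ≤ ∑ α ∈ nonSqfree ι p, (Nat.multinomial univ α : ℝ) ^ 2 * ∏ j, t j ^ α j :=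
    sum_nonneg fun α _ => mul_nonneg (by positivity) (hpos α)
  linarith

/-- AM-GM for multi-indices. -/
theorem prod_pow_le {ι : Type} [Fintype ι] [DecidableEq ι] (p : ℕ) (hp : p ≠ 0) (t : ι → ℝ)
    (ht : ∀ j, 0 ≤ t j) (α : ι → ℕ) (hα : α ∈ piAntidiag (univ : Finset ι) p) :
    ∏ j, t j ^ α j ≤ ∑ j, ((α j : ℝ) / p) * t j ^ p := by
  rw [mem_piAntidiag] at hα
  have hp' : (p : ℝ) ≠ 0 := by exact_mod_cast hp
  have hsum : ∑ j, (α j : ℝ) / p = 1 := by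
    rw [← sum_div, div_eq_one_iff_eq hp']; exact_mod_cast hα.1
  have := Real.geom_mean_le_arith_mean_weighted univ (fun j => (α j : ℝ) / p) (fun j => t j ^ p)
    (fun j _ => by positivity) hsum (fun j _ => pow_nonneg (ht j) _)
  refine le_trans (le_of_eq ?_) this
  apply prod_congr rfl; intro j _
  rw [← Real.rpow_natCast (t j) p, ← Real.rpow_mul (ht j), mul_div_cancel₀ _ hp', Real.rpow_natCast]

end Combinatorics

open MeasureTheory

section Haar

open Finset

theorem isCompact_unitary (d : ℕ) :
    IsCompact ((Matrix.unitaryGroup (Fin d) ℂ : Set (Matrix (Fin d) (Fin d) ℂ))) := by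
  have hsub : (Matrix.unitaryGroup (Fin d) ℂ : Set (Matrix (Fin d) (Fin d) ℂ)) ⊆
      Set.pi Set.univ (fun _ => Set.pi Set.univ (fun _ => Metric.closedBall (0 : ℂ) 1)) := by
    intro A hA i _ j _
    rw [mem_closedBall_zero_iff]
    exact entry_norm_bound_of_unitary hA i j
  have hc : IsCompact (Set.pi Set.univ (fun _ : Fin d => Set.pi Set.univ
      (fun _ : Fin d => Metric.closedBall (0 : ℂ) 1)) : Set (Matrix (Fin d) (Fin d) ℂ)) :=
    isCompact_univ_pi fun _ => isCompact_univ_pi fun _ => isCompact_closedBall _ _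
  refine hc.of_isClosed_subset ?_ hsub
  have : (Matrix.unitaryGroup (Fin d) ℂ : Set (Matrix (Fin d) (Fin d) ℂ)) =
      {A | A * star A = 1} := by
    ext A; simp [Matrix.mem_unitaryGroup_iff]
  rw [this]
  exact isClosed_eq (by fun_prop) continuous_const

instance compactSpace_unitary (d : ℕ) : CompactSpace (Matrix.unitaryGroup (Fin d) ℂ) :=
  isCompact_iff_compactSpace.1 (isCompact_unitary d)

variable {d : ℕ} [MeasurableSpace (Matrix.unitaryGroup (Fin d) ℂ)]
  [BorelSpace (Matrix.unitaryGroup (Fin d) ℂ)]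

/-- Left-invariant probability measure. -/
structure IsHaarU (P : Measure (Matrix.unitaryGroup (Fin d) ℂ)) : Prop where
  prob : IsProbabilityMeasure P
  inv : ∀ g : Matrix.unitaryGroup (Fin d) ℂ, P.map (fun x => g * x) = P

theorem IsHaarU.integrable {P : Measure (Matrix.unitaryGroup (Fin d) ℂ)} (hP : IsHaarU P)
    {E : Type} [NormedAddCommGroup E] [SecondCountableTopology E]
    {f : Matrix.unitaryGroup (Fin d) ℂ → E} (hf : Continuous f) : Integrable f P := by
  have := hP.prob
  exact hf.integrable_of_hasCompactSupport (HasCompactSupport.of_compactSpace f)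

theorem IsHaarU.left {P : Measure (Matrix.unitaryGroup (Fin d) ℂ)} (hP : IsHaarU P)
    {E : Type} [NormedAddCommGroup E] [NormedSpace ℝ E]
    (f : Matrix.unitaryGroup (Fin d) ℂ → E) (g : Matrix.unitaryGroup (Fin d) ℂ) :
    ∫ x, f (g * x) ∂P = ∫ x, f x ∂P := by
  have : P.IsMulLeftInvariant := ⟨hP.inv⟩
  exact integral_mul_left_eq_self f g

theorem IsHaarU.right {P : Measure (Matrix.unitaryGroup (Fin d) ℂ)} (hP : IsHaarU P)
    {E : Type} [NormedAddCommGroup E] [NormedSpace ℝ E]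
    (f : Matrix.unitaryGroup (Fin d) ℂ → E) (g : Matrix.unitaryGroup (Fin d) ℂ) :
    ∫ x, f (x * g) ∂P = ∫ x, f x ∂P := by
  have hl : P.IsMulLeftInvariant := ⟨hP.inv⟩
  have := hP.prob
  have hne : P ≠ 0 := IsProbabilityMeasure.ne_zero P
  have hh : P.IsHaarMeasure := by
    refine { lt_top_of_isCompact := fun K _ => measure_lt_top P K, open_pos := ?_ }
    exact (isOpenPosMeasure_of_mulLeftInvariant_of_compact Set.univ isCompact_univ
      (by simp)).open_pos
  have hr : P.IsMulRightInvariant := by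
    refine ⟨fun g => ?_⟩
    have hp : IsProbabilityMeasure (P.map (· * g)) :=
      Measure.isProbabilityMeasure_map (measurable_mul_const g).aemeasurable
    exact Measure.isHaarMeasure_eq_of_isProbabilityMeasure _ _
  exact integral_mul_right_eq_self f g

end Haar

open MeasureTheory

section Haar2

open Finset

theorem exists_unitary_col {d : ℕ} (K : Finset (Fin d)) (n : Fin d) (hn : n ∉ K)
    (z : Fin d → ℂ) (hz : ∀ k ∈ K, z k = 0) (h1 : ∑ r, ‖z r‖ ^ 2 = 1) :
    ∃ g : Matrix.unitaryGroup (Fin d) ℂ, (∀ r, g.1 r n = z r) ∧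
      ∀ k ∈ K, ∀ r, g.1 r k = if r = k then 1 else 0 := by
  let v : Fin d → EuclideanSpace ℂ (Fin d) := fun i =>
    if i = n then WithLp.toLp 2 z else EuclideanSpace.single i 1
  have hv : Orthonormal ℂ ((↑(insert n K) : Set (Fin d)).domRestrict v) := by
    rw [orthonormal_iff_ite]
    rintro ⟨i, hi⟩ ⟨j, hj⟩
    simp only [Set.domRestrict_apply, Subtype.mk.injEq, v]
    have hi' : i ≠ n → i ∈ K := by
      intro h; simpa [h] using hi
    have hj' : j ≠ n → j ∈ K := by
      intro h; simpa [h] using hj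
    by_cases hin : i = n <;> by_cases hjn : j = n
    · subst hin; subst hjn
      simp only [if_true]
      rw [inner_self_eq_norm_sq_to_K]
      have h2 : ‖(WithLp.toLp 2 z : EuclideanSpace ℂ (Fin d))‖ ^ 2 = 1 := by
        rw [EuclideanSpace.norm_sq_eq]; exact h1
      rw [← RCLike.ofReal_pow, h2, RCLike.ofReal_one]
    · have : n ≠ j := fun h => hjn h.symm
      subst hin
      simp only [if_true, if_neg hjn, if_neg this]
      rw [EuclideanSpace.inner_single_right]
      simp [hz j (hj' hjn)]
    · subst hjn
      simp only [if_true, if_neg hin]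
      rw [EuclideanSpace.inner_single_left]
      simp [hz i (hi' hin)]
    · simp only [if_neg hin, if_neg hjn]
      rw [EuclideanSpace.inner_single_left]
      simp
  obtain ⟨b, hb⟩ := hv.exists_orthonormalBasis_extension_of_card_eq (by simp)
  let g : Matrix (Fin d) (Fin d) ℂ := Matrix.of fun r c => b c r
  have hg : g ∈ Matrix.unitaryGroup (Fin d) ℂ := by
    rw [Matrix.mem_unitaryGroup_iff']
    ext i j
    rw [Matrix.mul_apply]
    have := orthonormal_iff_ite.1 b.orthonormal i j
    rw [PiLp.inner_apply] at this
    simp only [RCLike.inner_apply] at this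
    rw [Matrix.one_apply, ← this]
    apply sum_congr rfl; intro r _
    simp [g, Matrix.star_apply, mul_comm]
  refine ⟨⟨g, hg⟩, fun r => ?_, fun k hk r => ?_⟩
  · have := hb n (by simp)
    simp [g, this, v]
  · have := hb k (by simp [hk])
    have hkn : k ≠ n := fun h => hn (h ▸ hk)
    simp [g, this, v, hkn]

theorem cont_entry {d : ℕ} (j r : Fin d) :
    Continuous fun Ψ : Matrix.unitaryGroup (Fin d) ℂ => Ψ.1 j r :=
  (continuous_apply_apply j r).comp continuous_subtype_val

theorem sum_off {d : ℕ} {E : Type} [AddCommMonoid E] (K : Finset (Fin d)) (f : Fin d → E) :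
    ∑ r, f r = ∑ r : {r : Fin d // r ∉ K}, f r.1 + ∑ r ∈ K, f r := by
  rw [← Finset.sum_subtype Kᶜ (by simp) f, sum_compl_add_sum]

theorem parseval {d : ℕ} (Ψ : Matrix.unitaryGroup (Fin d) ℂ) (u : Fin d → ℂ) :
    ∑ r, ‖∑ j, u j * Ψ.1 j r‖ ^ 2 = ∑ j, ‖u j‖ ^ 2 := by
  have hΨ : Ψ.1 * Ψ.1.conjTranspose = 1 := Matrix.mem_unitaryGroup_iff.1 Ψ.2
  have h : (Matrix.vecMul u Ψ.1) ⬝ᵥ star (Matrix.vecMul u Ψ.1) = u ⬝ᵥ star u := by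
    rw [Matrix.star_vecMul, Matrix.dotProduct_mulVec, Matrix.vecMul_vecMul, hΨ, Matrix.vecMul_one]
  apply Complex.ofReal_injective
  push_cast
  simp only [dotProduct, Pi.star_apply, Matrix.vecMul] at h
  simpa only [← Complex.mul_conj', starRingEnd_apply] using h

variable {d : ℕ} [MeasurableSpace (Matrix.unitaryGroup (Fin d) ℂ)]
  [BorelSpace (Matrix.unitaryGroup (Fin d) ℂ)]

theorem moment_of_inv {P : Measure (Matrix.unitaryGroup (Fin d) ℂ)} (hP : IsHaarU P)
    {ι : Type} [Fintype ι] [DecidableEq ι] [Nonempty ι] (p : ℕ)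
    (w : Matrix.unitaryGroup (Fin d) ℂ → ι → ℂ) (hw : ∀ r, Continuous fun Ψ => w Ψ r) (M : ℝ)
    (hM : ∀ z : ι → ℂ, ∑ r, ‖z r‖ ^ 2 = 1 → ∫ Ψ, ‖∑ r, z r * w Ψ r‖ ^ (2 * p) ∂P = M) :
    ∀ α ∈ piAntidiag (univ : Finset ι) p,
      (Nat.multinomial univ α : ℝ) * ∫ Ψ, ∏ r, (‖w Ψ r‖ ^ 2) ^ α r ∂P = M := by
  have := hP.prob
  have hhom : ∀ z : ι → ℂ, ∫ Ψ, ‖∑ r, z r * w Ψ r‖ ^ (2 * p) ∂P = (∑ r, ‖z r‖ ^ 2) ^ p * M := by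
    intro z
    set s := ∑ r, ‖z r‖ ^ 2 with hs
    have hs0 : 0 ≤ s := sum_nonneg fun _ _ => by positivity
    rcases hs0.eq_or_lt with h0 | h0
    · have hz : ∀ r, z r = 0 := by
        intro r
        have := (sum_eq_zero_iff_of_nonneg (fun r _ => by positivity)).1 (hs ▸ h0.symm) r (mem_univ r)
        simpa using this
      simp only [hz]
      rcases Nat.eq_zero_or_pos p with hp | hp
      · subst hp
        obtain ⟨r0⟩ := ‹Nonempty ι›
        have := hM (Pi.single r0 1) (by
          rw [sum_eq_single r0] <;> simp +contextual)
        simpa using this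
      · rw [← h0]; simp [hp.ne']
    · have hsq : (0 : ℝ) < Real.sqrt s := Real.sqrt_pos.2 h0
      have h2 := hM (fun r => z r / (Real.sqrt s : ℂ)) (by
        simp only [norm_div, Complex.norm_real, Real.norm_eq_abs, abs_of_pos hsq, div_pow,
          Real.sq_sqrt hs0]
        rw [← sum_div, ← hs, div_self h0.ne'])
      rw [← h2, ← integral_const_mul]
      congr 1; funext Ψ
      have : ∑ r, z r / (Real.sqrt s : ℂ) * w Ψ r = (∑ r, z r * w Ψ r) / (Real.sqrt s : ℂ) := by
        rw [sum_div]; apply sum_congr rfl; intro r _; ring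
      rw [this, norm_div, Complex.norm_real, Real.norm_eq_abs, abs_of_pos hsq, div_pow, pow_mul (Real.sqrt s),
        Real.sq_sqrt hs0]
      field_simp
  intro α hα
  have hmul : (Nat.multinomial univ α : ℝ) ≠ 0 := by
    exact_mod_cast (Nat.multinomial_pos _ _).ne'
  have key := coeff_compare p
    (fun α => (Nat.multinomial univ α : ℝ) ^ 2 * ∫ Ψ, ∏ r, (‖w Ψ r‖ ^ 2) ^ α r ∂P)
    (fun α => (Nat.multinomial univ α : ℝ) * M) (fun x => by
      have hζ := Complex.isPrimitiveRoot_exp (p + 1) (by omega)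
      set ζ := Complex.exp (2 * Real.pi * Complex.I / ((p + 1 : ℕ) : ℂ)) with hζd
      have hn : ‖ζ‖ = 1 := hζ.norm'_eq_one (by omega)
      have e1 : ∀ Ψ, ∑ y : ι → Fin (p + 1), ‖∑ j, (ζ ^ (y j : ℕ) * x j) * w Ψ j‖ ^ (2 * p) =
          ((p : ℝ) + 1) ^ (Fintype.card ι) * ∑ α ∈ piAntidiag (univ : Finset ι) p,
          (Nat.multinomial univ α : ℝ) ^ 2 * ((∏ r, (‖w Ψ r‖ ^ 2) ^ α r) * ∏ j, (x j ^ 2) ^ α j) := by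
        intro Ψ
        have := phase_avg p ζ hζ (fun j => x j * w Ψ j)
        simp only [mul_assoc] at this ⊢
        rw [this]
        simp only [norm_mul, mul_pow, prod_mul_distrib, Complex.norm_real, Real.norm_eq_abs, sq_abs]
        congr 1
        apply sum_congr rfl; intro α _
        ring
      have e2 := congrArg (fun F : Matrix.unitaryGroup (Fin d) ℂ → ℝ => ∫ Ψ, F Ψ ∂P) (funext e1)
      rw [integral_finsetSum _ (fun y _ => hP.integrable (by fun_prop)), integral_const_mul,
        integral_finsetSum _ (fun y _ => hP.integrable (by fun_prop))] at e2
      simp only [hhom] at e2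
      have e3 : ∀ y : ι → Fin (p + 1), ∑ r, ‖ζ ^ (y r : ℕ) * (x r : ℂ)‖ ^ 2 = ∑ r, x r ^ 2 := by
        intro y
        apply sum_congr rfl; intro r _
        simp [hn]
      simp only [e3] at e2
      have hcard : ((p : ℝ) + 1) ^ (Fintype.card ι) ≠ 0 := by positivity
      rw [sum_const, card_univ, Fintype.card_fun, Fintype.card_fin, nsmul_eq_mul] at e2
      push_cast at e2
      have e4 := mul_left_cancel₀ hcard e2
      rw [sum_pow_eq_sum_piAntidiag, sum_mul] at e4
      rw [eq_comm]
      calc _ = _ := by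
            apply sum_congr rfl; intro α _; ring
        _ = _ := e4
        _ = _ := by
            apply sum_congr rfl; intro α _
            rw [integral_const_mul, integral_mul_const]; ring) α hα
  apply mul_left_cancel₀ hmul
  rw [← key]; ring

theorem moment_sum_of_inv {P : Measure (Matrix.unitaryGroup (Fin d) ℂ)} (hP : IsHaarU P)
    {ι : Type} [Fintype ι] [DecidableEq ι] [Nonempty ι] (p : ℕ)
    (w : Matrix.unitaryGroup (Fin d) ℂ → ι → ℂ) (hw : ∀ r, Continuous fun Ψ => w Ψ r) (M : ℝ)
    (hM : ∀ z : ι → ℂ, ∑ r, ‖z r‖ ^ 2 = 1 → ∫ Ψ, ‖∑ r, z r * w Ψ r‖ ^ (2 * p) ∂P = M) :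
    (p.factorial : ℝ) * ∫ Ψ, (∑ r, ‖w Ψ r‖ ^ 2) ^ p ∂P = (Fintype.card ι).ascFactorial p * M := by
  have h := moment_of_inv hP p w hw M hM
  simp_rw [sum_pow_eq_sum_piAntidiag]
  rw [integral_finsetSum _ (fun y _ => hP.integrable (by fun_prop))]
  simp_rw [integral_const_mul]
  rw [sum_congr rfl h, sum_const, nsmul_eq_mul, ← card_piAntidiag_univ]
  push_cast; ring

/-- Column lemma. -/
theorem column_moment {P : Measure (Matrix.unitaryGroup (Fin d) ℂ)} (hP : IsHaarU P)
    (p : ℕ) (K : Finset (Fin d)) (n : Fin d) (hn : n ∉ K)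
    (u : Matrix.unitaryGroup (Fin d) ℂ → Fin d → ℂ) (hu : ∀ j, Continuous fun Ψ => u Ψ j)
    (hK : ∀ Ψ Φ : Matrix.unitaryGroup (Fin d) ℂ, (∀ j, ∀ k ∈ K, Ψ.1 j k = Φ.1 j k) → u Ψ = u Φ) :
    (p.factorial : ℝ) * ∫ Ψ, (∑ j, ‖u Ψ j‖ ^ 2 - ∑ r ∈ K, ‖∑ j, u Ψ j * Ψ.1 j r‖ ^ 2) ^ p ∂P =
      (d - K.card).ascFactorial p * ∫ Ψ, ‖∑ j, u Ψ j * Ψ.1 j n‖ ^ (2 * p) ∂P := by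
  let ι := {r : Fin d // r ∉ K}
  have : Nonempty ι := ⟨⟨n, hn⟩⟩
  have hcard : Fintype.card ι = d - K.card := by
    simp [ι, Fintype.card_subtype_compl]
  have hcont : ∀ r, Continuous fun Ψ : Matrix.unitaryGroup (Fin d) ℂ => ∑ j, u Ψ j * Ψ.1 j r := by
    intro r
    exact continuous_finsetSum _ fun j _ => (hu j).mul (cont_entry j r)
  have key := moment_sum_of_inv hP p (ι := ι) (fun Ψ r => ∑ j, u Ψ j * Ψ.1 j r.1)
    (fun r => hcont r.1) (∫ Ψ, ‖∑ j, u Ψ j * Ψ.1 j n‖ ^ (2 * p) ∂P) (by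
      intro z hz
      let z' : Fin d → ℂ := fun r => if h : r ∉ K then z ⟨r, h⟩ else 0
      have hz1 : ∑ r, ‖z' r‖ ^ 2 = 1 := by
        rw [← hz, sum_off K, sum_eq_zero (s := K), add_zero]
        · apply sum_congr rfl; intro r _
          simp [z', r.2]
        · intro r hr; simp [z', hr]
      obtain ⟨g, hg1, hg2⟩ := exists_unitary_col K n hn z' (fun k hk => by simp [z', hk]) hz1
      rw [← hP.right (fun Ψ => ‖∑ j, u Ψ j * Ψ.1 j n‖ ^ (2 * p)) g]
      congr 1; funext Ψ
      have e1 : u (Ψ * g) = u Ψ := by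
        apply hK
        intro j k hk
        change (Ψ.1 * g.1) j k = _
        rw [Matrix.mul_apply]
        simp [hg2 k hk]
      have e2 : ∀ j, (Ψ * g).1 j n = ∑ r : ι, z r * Ψ.1 j r.1 := by
        intro j
        change (Ψ.1 * g.1) j n = _
        rw [Matrix.mul_apply, sum_off K, sum_eq_zero (s := K), add_zero]
        · apply sum_congr rfl; intro r _
          simp [hg1, z', r.2, mul_comm]
        · intro r hr; simp [hg1, z', hr]
      rw [e1]
      simp only [e2, mul_sum]
      rw [sum_comm]
      congr 2
      apply sum_congr rfl; intro j _
      apply sum_congr rfl; intro r _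
      ring)
  rw [hcard] at key
  rw [← key]
  congr 2; funext Ψ; congr 1
  rw [← parseval Ψ, sum_off K, add_sub_cancel_right]

/-- Row-index moments of one column. -/
theorem row_moment {P : Measure (Matrix.unitaryGroup (Fin d) ℂ)} (hP : IsHaarU P)
    (p : ℕ) (k : Fin d) (α : Fin d → ℕ) (hα : α ∈ piAntidiag (univ : Finset (Fin d)) p) :
    ∫ Ψ, ∏ j, (‖Ψ.1 j k‖ ^ 2) ^ α j ∂P = (∏ j, (α j).factorial : ℕ) / (d.ascFactorial p : ℝ) := by
  have := hP.prob
  have : Nonempty (Fin d) := ⟨k⟩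
  have hM : ∀ z : Fin d → ℂ, ∑ r, ‖z r‖ ^ 2 = 1 →
      ∫ Ψ, ‖∑ r, z r * Ψ.1 r k‖ ^ (2 * p) ∂P = ∫ Ψ, ‖Ψ.1 k k‖ ^ (2 * p) ∂P := by
    intro z hz
    obtain ⟨g, hg1, -⟩ := exists_unitary_col ∅ k (by simp) (fun r => (starRingEnd ℂ) (z r))
      (by simp) (by simpa using hz)
    rw [← hP.left (fun Ψ => ‖Ψ.1 k k‖ ^ (2 * p)) g⁻¹]
    congr 1; funext Ψ
    congr 2
    change _ = (star g.1 * Ψ.1) k k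
    rw [Matrix.mul_apply]
    apply sum_congr rfl; intro r _
    rw [Matrix.star_apply, hg1]; simp
  have h1 := moment_of_inv hP p (fun Ψ r => Ψ.1 r k) (fun r => cont_entry r k) _ hM α hα
  have h2 := moment_sum_of_inv hP p (fun Ψ r => Ψ.1 r k) (fun r => cont_entry r k) _ hM
  have h3 : ∀ Ψ : Matrix.unitaryGroup (Fin d) ℂ, ∑ r, ‖Ψ.1 r k‖ ^ 2 = 1 := by
    intro Ψ
    have := Matrix.mem_unitaryGroup_iff'.1 Ψ.2
    have := congrFun (congrFun this k) k
    rw [Matrix.mul_apply, Matrix.one_apply_eq] at this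
    apply Complex.ofReal_injective
    push_cast
    rw [← this]
    apply sum_congr rfl; intro r _
    rw [Matrix.star_apply, ← Complex.conj_mul']; rfl
  simp only [h3, one_pow, integral_const, probReal_univ, smul_eq_mul, mul_one, Fintype.card_fin] at h2
  rw [← h1] at h2
  have hd : 0 < d := k.pos
  have hasc : (d.ascFactorial p : ℝ) ≠ 0 := by
    obtain ⟨e, rfl⟩ : ∃ e, d = e + 1 := ⟨d - 1, by omega⟩
    exact_mod_cast (Nat.ascFactorial_pos e p).ne'
  have hspec := Nat.multinomial_spec (univ : Finset (Fin d)) α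
  rw [mem_piAntidiag] at hα
  rw [hα.1] at hspec
  have hmul : (Nat.multinomial univ α : ℝ) ≠ 0 := by
    exact_mod_cast (Nat.multinomial_pos _ _).ne'
  rw [eq_div_iff hasc]
  apply mul_left_cancel₀ hmul
  rw [← hspec] at h2
  push_cast at h2 ⊢
  linarith

end Haar2

open MeasureTheory

section Haar3

open Finset

/-- matrix entry -/
def ent {d : ℕ} (Ψ : Matrix.unitaryGroup (Fin d) ℂ) (j k : Fin d) : ℂ := Ψ.1 j k

theorem ent_def {d : ℕ} (Ψ : Matrix.unitaryGroup (Fin d) ℂ) (j k : Fin d) :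
    Ψ.1 j k = ent Ψ j k := rfl

@[fun_prop]
theorem cont_ent {d : ℕ} (j k : Fin d) :
    Continuous fun Ψ : Matrix.unitaryGroup (Fin d) ℂ => ent Ψ j k := cont_entry j k

/-- squared modulus of a matrix entry -/
noncomputable def sqn {d : ℕ} (Ψ : Matrix.unitaryGroup (Fin d) ℂ) (j k : Fin d) : ℝ :=
  ‖Ψ.1 j k‖ ^ 2

theorem sqn_nonneg {d : ℕ} (Ψ : Matrix.unitaryGroup (Fin d) ℂ) (j k : Fin d) : 0 ≤ sqn Ψ j k := by
  unfold sqn; positivity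

@[fun_prop]
theorem cont_sqn {d : ℕ} (j k : Fin d) :
    Continuous fun Ψ : Matrix.unitaryGroup (Fin d) ℂ => sqn Ψ j k := by
  unfold sqn
  simp only [ent_def]
  fun_prop

theorem sqn_sum_row {d : ℕ} (Ψ : Matrix.unitaryGroup (Fin d) ℂ) (k : Fin d) :
    ∑ j, sqn Ψ j k = 1 := by
  have := Matrix.mem_unitaryGroup_iff'.1 Ψ.2
  have := congrFun (congrFun this k) k
  rw [Matrix.mul_apply, Matrix.one_apply_eq] at this
  apply Complex.ofReal_injective
  push_cast [sqn]
  rw [← this]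
  apply sum_congr rfl; intro r _
  rw [Matrix.star_apply, ← Complex.conj_mul']; rfl

theorem bessel {d : ℕ} (K : Finset (Fin d)) (Ψ : Matrix.unitaryGroup (Fin d) ℂ) (u : Fin d → ℂ) :
    0 ≤ ∑ j, ‖u j‖ ^ 2 - ∑ r ∈ K, ‖∑ j, u j * Ψ.1 j r‖ ^ 2 := by
  rw [← parseval Ψ, sum_off K, add_sub_cancel_right]
  positivity

variable {d : ℕ} [MeasurableSpace (Matrix.unitaryGroup (Fin d) ℂ)]
  [BorelSpace (Matrix.unitaryGroup (Fin d) ℂ)]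

theorem sqn_moment {P : Measure (Matrix.unitaryGroup (Fin d) ℂ)} (hP : IsHaarU P)
    (p : ℕ) (j k : Fin d) :
    ∫ Ψ, sqn Ψ j k ^ p ∂P = p.factorial / (d.ascFactorial p : ℝ) := by
  have h := row_moment hP p k (Pi.single j p) (by simp [mem_piAntidiag])
  have e1 : ∀ Ψ : Matrix.unitaryGroup (Fin d) ℂ,
      ∏ i, (‖Ψ.1 i k‖ ^ 2) ^ (Pi.single j p : Fin d → ℕ) i = sqn Ψ j k ^ p := by
    intro Ψ
    rw [prod_eq_single j]
    · simp [sqn]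
    · intro b _ hb; simp [hb]
    · simp
  have e2 : ∏ i, ((Pi.single j p : Fin d → ℕ) i).factorial = p.factorial := by
    rw [prod_eq_single j]
    · simp
    · intro b _ hb; simp [hb]
    · simp
  simp only [e1, e2] at h
  exact h

theorem sqn_moment_le {P : Measure (Matrix.unitaryGroup (Fin d) ℂ)} (hP : IsHaarU P)
    (p : ℕ) (j k : Fin d) :
    ∫ Ψ, sqn Ψ j k ^ p ∂P ≤ p.factorial / (d : ℝ) ^ p := by
  rw [sqn_moment hP]
  have hd : 0 < d := j.pos
  apply div_le_div_of_nonneg_left (by positivity) (by positivity)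
  have : d ^ p ≤ d.ascFactorial p := Nat.pow_succ_le_ascFactorial _ p
  exact_mod_cast this

theorem col_upper {P : Measure (Matrix.unitaryGroup (Fin d) ℂ)} (hP : IsHaarU P)
    (p : ℕ) (K : Finset (Fin d)) (n : Fin d) (hn : n ∉ K)
    (u : Matrix.unitaryGroup (Fin d) ℂ → Fin d → ℂ) (hu : ∀ j, Continuous fun Ψ => u Ψ j)
    (hK : ∀ Ψ Φ : Matrix.unitaryGroup (Fin d) ℂ, (∀ j, ∀ k ∈ K, Ψ.1 j k = Φ.1 j k) → u Ψ = u Φ) :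
    ∫ Ψ, ‖∑ j, u Ψ j * Ψ.1 j n‖ ^ (2 * p) ∂P ≤
      p.factorial / ((d : ℝ) - K.card) ^ p * ∫ Ψ, (∑ j, ‖u Ψ j‖ ^ 2) ^ p ∂P := by
  have h := column_moment hP p K n hn u hu hK
  have hlt : K.card < d := by
    have := card_lt_card (ssubset_univ_iff.2 (fun h => hn (h ▸ mem_univ n)) : K ⊂ univ)
    simpa using this
  have hpos : (0 : ℝ) < (d : ℝ) - K.card := by
    have : (K.card : ℝ) < d := by exact_mod_cast hlt
    linarith
  have hasc : ((d : ℝ) - K.card) ^ p ≤ ((d - K.card).ascFactorial p : ℝ) := by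
    rw [← Nat.cast_sub hlt.le]
    have : (d - K.card) ^ p ≤ (d - K.card).ascFactorial p := Nat.pow_succ_le_ascFactorial _ p
    exact_mod_cast this
  have hle : ∫ Ψ, (∑ j, ‖u Ψ j‖ ^ 2 - ∑ r ∈ K, ‖∑ j, u Ψ j * Ψ.1 j r‖ ^ 2) ^ p ∂P ≤
      ∫ Ψ, (∑ j, ‖u Ψ j‖ ^ 2) ^ p ∂P := by
    apply integral_mono (hP.integrable (by (try simp only [ent_def]); fun_prop)) (hP.integrable (by (try simp only [ent_def]); fun_prop))
    intro Ψ
    apply pow_le_pow_left₀ (bessel K Ψ _)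
    have : 0 ≤ ∑ r ∈ K, ‖∑ j, u Ψ j * Ψ.1 j r‖ ^ 2 := by positivity
    linarith
  have h0 : 0 ≤ ∫ Ψ, ‖∑ j, u Ψ j * Ψ.1 j n‖ ^ (2 * p) ∂P :=
    integral_nonneg fun Ψ => by positivity
  rw [div_mul_eq_mul_div, le_div_iff₀ (by positivity), mul_comm]
  calc _ ≤ ((d - K.card).ascFactorial p : ℝ) * ∫ Ψ, ‖∑ j, u Ψ j * Ψ.1 j n‖ ^ (2 * p) ∂P :=
        mul_le_mul_of_nonneg_right hasc h0
    _ = _ := h.symm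
    _ ≤ _ := mul_le_mul_of_nonneg_left hle (by positivity)

theorem col_lower {P : Measure (Matrix.unitaryGroup (Fin d) ℂ)} (hP : IsHaarU P)
    (p : ℕ) (K : Finset (Fin d)) (n : Fin d) (hn : n ∉ K)
    (u : Matrix.unitaryGroup (Fin d) ℂ → Fin d → ℂ) (hu : ∀ j, Continuous fun Ψ => u Ψ j)
    (hK : ∀ Ψ Φ : Matrix.unitaryGroup (Fin d) ℂ, (∀ j, ∀ k ∈ K, Ψ.1 j k = Φ.1 j k) → u Ψ = u Φ) :
    p.factorial / ((d : ℝ) + p) ^ p *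
      (∫ Ψ, (∑ j, ‖u Ψ j‖ ^ 2 - ∑ r ∈ K, ‖∑ j, u Ψ j * Ψ.1 j r‖ ^ 2) ∂P) ^ p ≤
      ∫ Ψ, ‖∑ j, u Ψ j * Ψ.1 j n‖ ^ (2 * p) ∂P := by
  have h := column_moment hP p K n hn u hu hK
  have := hP.prob
  have hd : 0 < d := n.pos
  have hasc : ((d - K.card).ascFactorial p : ℝ) ≤ ((d : ℝ) + p) ^ p := by
    have h1 : (d - K.card).ascFactorial p ≤ (d + p) ^ p := by
      refine le_trans ?_ (Nat.ascFactorial_le_pow_add d p)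
      have : d - K.card ≤ d + 1 := by omega
      generalize d - K.card = a at this
      clear h
      induction p with
      | zero => simp
      | succ p ih =>
        rw [Nat.ascFactorial_succ, Nat.ascFactorial_succ]
        exact Nat.mul_le_mul (by omega) ih
    exact_mod_cast h1
  have hJ := (convexOn_pow (𝕜 := ℝ) p).map_integral_le (μ := P) (f := fun Ψ =>
    ∑ j, ‖u Ψ j‖ ^ 2 - ∑ r ∈ K, ‖∑ j, u Ψ j * Ψ.1 j r‖ ^ 2)
    (by exact (continuous_pow p).continuousOn) isClosed_Ici (Filter.Eventually.of_forall fun Ψ => bessel K Ψ _)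
    (hP.integrable (by (try simp only [ent_def]); fun_prop)) (hP.integrable (by simp only [Function.comp_def, ent_def]; fun_prop))
  have h0 : 0 ≤ ∫ Ψ, ‖∑ j, u Ψ j * Ψ.1 j n‖ ^ (2 * p) ∂P :=
    integral_nonneg fun Ψ => by positivity
  rw [div_mul_eq_mul_div, div_le_iff₀ (by positivity), mul_comm (∫ Ψ, ‖∑ j, u Ψ j * Ψ.1 j n‖ ^ (2 * p) ∂P)]
  calc _ ≤ (p.factorial : ℝ) * ∫ Ψ, (∑ j, ‖u Ψ j‖ ^ 2 - ∑ r ∈ K, ‖∑ j, u Ψ j * Ψ.1 j r‖ ^ 2) ^ p ∂P :=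
        mul_le_mul_of_nonneg_left hJ (by positivity)
    _ = _ := h
    _ ≤ _ := mul_le_mul_of_nonneg_right hasc h0

/-- mixed moment bound -/
theorem prod_moment_le {P : Measure (Matrix.unitaryGroup (Fin d) ℂ)} (hP : IsHaarU P)
    (p : ℕ) (hp : p ≠ 0) (s : Matrix.unitaryGroup (Fin d) ℂ → Fin d → ℝ)
    (hs : ∀ j, Continuous fun Ψ => s Ψ j) (hs0 : ∀ Ψ j, 0 ≤ s Ψ j) (B : ℝ)
    (hB : ∀ j, ∫ Ψ, s Ψ j ^ p ∂P ≤ B) (α : Fin d → ℕ)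
    (hα : α ∈ piAntidiag (univ : Finset (Fin d)) p) :
    ∫ Ψ, ∏ j, s Ψ j ^ α j ∂P ≤ B := by
  have h1 : ∫ Ψ, ∏ j, s Ψ j ^ α j ∂P ≤ ∫ Ψ, ∑ j, ((α j : ℝ) / p) * s Ψ j ^ p ∂P := by
    apply integral_mono (hP.integrable (by (try simp only [ent_def]); fun_prop)) (hP.integrable (by (try simp only [ent_def]); fun_prop))
    intro Ψ
    exact prod_pow_le p hp _ (hs0 Ψ) α hα
  refine h1.trans ?_
  rw [integral_finsetSum _ (fun y _ => hP.integrable (by (try simp only [ent_def]); fun_prop))]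
  simp_rw [integral_const_mul]
  calc _ ≤ ∑ j, (α j : ℝ) / p * B :=
        sum_le_sum fun j _ => mul_le_mul_of_nonneg_left (hB j) (by positivity)
    _ = B := by
        rw [← sum_mul, ← sum_div, ← Nat.cast_sum, (mem_piAntidiag.1 hα).1,
          div_self (by exact_mod_cast hp), one_mul]

theorem nonSqfree_moment_le {P : Measure (Matrix.unitaryGroup (Fin d) ℂ)} (hP : IsHaarU P)
    (p : ℕ) (hp : p ≠ 0) (s : Matrix.unitaryGroup (Fin d) ℂ → Fin d → ℝ)
    (hs : ∀ j, Continuous fun Ψ => s Ψ j) (hs0 : ∀ Ψ j, 0 ≤ s Ψ j) (B : ℝ)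
    (hB : ∀ j, ∫ Ψ, s Ψ j ^ p ∂P ≤ B) :
    ∫ Ψ, ∑ α ∈ nonSqfree (Fin d) p, ∏ j, s Ψ j ^ α j ∂P ≤ (nonSqfree (Fin d) p).card * B := by
  rw [integral_finsetSum _ (fun y _ => hP.integrable (by (try simp only [ent_def]); fun_prop)), ← nsmul_eq_mul]
  apply sum_le_card_nsmul
  intro α hα
  exact prod_moment_le hP p hp s hs hs0 B hB α (nonSqfree_subset hα)

theorem lemma_S {P : Measure (Matrix.unitaryGroup (Fin d) ℂ)} (hP : IsHaarU P)
    (p : ℕ) (hp : p ≠ 0) (K : Finset (Fin d)) (n : Fin d) (hn : n ∉ K)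
    (u : Matrix.unitaryGroup (Fin d) ℂ → Fin d → ℂ) (hu : ∀ j, Continuous fun Ψ => u Ψ j)
    (hK : ∀ Ψ Φ : Matrix.unitaryGroup (Fin d) ℂ, (∀ j, ∀ k ∈ K, Ψ.1 j k = Φ.1 j k) → u Ψ = u Φ)
    (B : ℝ) (hB : ∀ j, ∫ Ψ, (‖u Ψ j‖ ^ 2 * sqn Ψ j n) ^ p ∂P ≤ B) :
    ∫ Ψ, (∑ j, ‖u Ψ j‖ ^ 2 * sqn Ψ j n) ^ p ∂P ≤
      1 / ((d : ℝ) - K.card) ^ p * (∫ Ψ, (∑ j, ‖u Ψ j‖ ^ 2) ^ p ∂P) +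
      p.factorial * (nonSqfree (Fin d) p).card * B := by
  have hζ := Complex.isPrimitiveRoot_exp (p + 1) (by omega)
  set ζ := Complex.exp (2 * Real.pi * Complex.I / ((p + 1 : ℕ) : ℂ)) with hζd
  have hnorm : ‖ζ‖ = 1 := hζ.norm'_eq_one (by omega)
  have hs : ∀ j, Continuous fun Ψ => ‖u Ψ j‖ ^ 2 * sqn Ψ j n := by intro j; fun_prop
  have hs0 : ∀ Ψ j, 0 ≤ ‖u Ψ j‖ ^ 2 * sqn Ψ j n := fun Ψ j =>
    mul_nonneg (by positivity) (sqn_nonneg _ _ _)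
  have h1 : ∫ Ψ, p.factorial * (∑ j, ‖u Ψ j‖ ^ 2 * sqn Ψ j n) ^ p ∂P ≤
      ∫ Ψ, (∑ α ∈ piAntidiag (univ : Finset (Fin d)) p, (Nat.multinomial univ α : ℝ) ^ 2 *
        ∏ j, (‖u Ψ j‖ ^ 2 * sqn Ψ j n) ^ α j
      + (p.factorial : ℝ) ^ 2 * ∑ α ∈ nonSqfree (Fin d) p, ∏ j, (‖u Ψ j‖ ^ 2 * sqn Ψ j n) ^ α j) ∂P := by
    apply integral_mono (hP.integrable (by (try simp only [ent_def]); fun_prop)) (hP.integrable (by (try simp only [ent_def]); fun_prop))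
    intro Ψ
    exact pow_sum_le p _ (hs0 Ψ)
  rw [integral_const_mul, integral_add (hP.integrable (by (try simp only [ent_def]); fun_prop)) (hP.integrable (by (try simp only [ent_def]); fun_prop)),
    integral_const_mul] at h1
  have h2 := nonSqfree_moment_le hP p hp _ hs hs0 B hB
  have h3 : ∫ Ψ, ∑ α ∈ piAntidiag (univ : Finset (Fin d)) p, (Nat.multinomial univ α : ℝ) ^ 2 *
        ∏ j, (‖u Ψ j‖ ^ 2 * sqn Ψ j n) ^ α j ∂P ≤
      p.factorial / ((d : ℝ) - K.card) ^ p * ∫ Ψ, (∑ j, ‖u Ψ j‖ ^ 2) ^ p ∂P := by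
    have hq : (0 : ℝ) < ((p : ℝ) + 1) ^ (Fintype.card (Fin d)) := by positivity
    apply le_of_mul_le_mul_left _ hq
    rw [← integral_const_mul]
    have e : ∀ Ψ, ((p : ℝ) + 1) ^ (Fintype.card (Fin d)) *
        ∑ α ∈ piAntidiag (univ : Finset (Fin d)) p, (Nat.multinomial univ α : ℝ) ^ 2 *
        ∏ j, (‖u Ψ j‖ ^ 2 * sqn Ψ j n) ^ α j =
        ∑ y : Fin d → Fin (p + 1), ‖∑ j, (ζ ^ (y j : ℕ) * u Ψ j) * Ψ.1 j n‖ ^ (2 * p) := by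
      intro Ψ
      have := phase_avg p ζ hζ (fun j => u Ψ j * Ψ.1 j n)
      simp only [mul_assoc] at this ⊢
      rw [this]
      simp only [norm_mul, mul_pow, sqn]
    simp_rw [e]
    rw [integral_finsetSum _ (fun y _ => hP.integrable (by (try simp only [ent_def]); fun_prop))]
    calc _ ≤ ∑ y : Fin d → Fin (p + 1), p.factorial / ((d : ℝ) - K.card) ^ p *
          ∫ Ψ, (∑ j, ‖u Ψ j‖ ^ 2) ^ p ∂P := by
          apply sum_le_sum; intro y _
          have := col_upper hP p K n hn (fun Ψ j => ζ ^ (y j : ℕ) * u Ψ j)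
            (fun j => by fun_prop) (fun Ψ Φ h => by rw [hK Ψ Φ h])
          simpa only [norm_mul, norm_pow, hnorm, one_pow, one_mul] using this
      _ = _ := by
          rw [sum_const, card_univ, Fintype.card_fun, Fintype.card_fin, nsmul_eq_mul]
          push_cast; ring
  have hf : (0 : ℝ) < p.factorial := by positivity
  apply le_of_mul_le_mul_left _ hf
  refine h1.trans ((add_le_add h3 (mul_le_mul_of_nonneg_left h2 (by positivity))).trans (le_of_eq ?_))
  ring

end Haar3

open MeasureTheory

section RealAsymp

open Finset

theorem one_add_pow_le_aux (p : ℕ) (y : ℝ) (hy : 0 ≤ y) (hy1 : y ≤ 1) :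
    (1 + y) ^ p ≤ 1 + (2 ^ p - 1) * y := by
  induction p with
  | zero => simp
  | succ p ih =>
    have h2 : (1 : ℝ) ≤ 2 ^ p := one_le_pow₀ (by norm_num)
    have h3 : (1 + y) ^ p * (1 + y) ≤ (1 + (2 ^ p - 1) * y) * (1 + y) :=
      mul_le_mul_of_nonneg_right ih (by linarith)
    have h4 : (2 ^ p - 1) * (y * y) ≤ (2 ^ p - 1) * y :=
      mul_le_mul_of_nonneg_left (by nlinarith) (by linarith)
    rw [pow_succ, pow_succ]
    linarith

theorem one_add_pow_le' (p : ℕ) (y : ℝ) (hy : 0 ≤ y) (hy1 : y ≤ 1) :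
    (1 + y) ^ p ≤ 1 + 2 ^ p * y := by
  have := one_add_pow_le_aux p y hy hy1
  linarith

theorem inv_sub_pow_le (p κ : ℕ) : ∃ C : ℝ, 0 ≤ C ∧ ∃ D : ℕ, ∀ d : ℕ, D ≤ d →
    κ < d ∧ 1 / ((d : ℝ) - κ) ^ p ≤ (1 + C / d) / (d : ℝ) ^ p := by
  refine ⟨2 ^ p * (2 * κ), by positivity, 2 * κ + 1, fun d hd => ⟨by omega, ?_⟩⟩
  have hd' : 2 * (κ : ℝ) + 1 ≤ d := by exact_mod_cast hd
  have hκ : (0 : ℝ) ≤ κ := by positivity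
  have hd0 : (0 : ℝ) < d := by linarith
  have hs : (0 : ℝ) < d - κ := by linarith
  have h1 := one_add_pow_le' p (2 * κ / d) (by positivity) (by rw [div_le_one hd0]; linarith)
  rw [div_le_div_iff₀ (by positivity) (by positivity), one_mul]
  calc (d : ℝ) ^ p ≤ ((1 + 2 * κ / d) * (d - κ)) ^ p := by
        apply pow_le_pow_left₀ hd0.le
        have : (1 + 2 * κ / d) * ((d : ℝ) - κ) = d + κ * (d - 2 * κ) / d := by field_simp; ring
        rw [this]
        have : 0 ≤ κ * ((d : ℝ) - 2 * κ) / d := by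
          apply div_nonneg (mul_nonneg hκ (by linarith)) hd0.le
        linarith
    _ = (1 + 2 * κ / d) ^ p * (d - κ) ^ p := mul_pow _ _ _
    _ ≤ _ := by
        apply mul_le_mul_of_nonneg_right _ (by positivity)
        rw [mul_div_assoc (2 ^ p)]; exact h1

theorem asc_le_real (p : ℕ) (d : ℕ) (hd : p + 1 ≤ d) :
    (d.ascFactorial p : ℝ) ≤ (d : ℝ) ^ p * (1 + 2 ^ p * p / d) := by
  have hd0 : (0 : ℝ) < d := by exact_mod_cast (by omega : 0 < d)
  have h1 : (d.ascFactorial p) ≤ (d + p) ^ p := by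
    refine le_trans ?_ (Nat.ascFactorial_le_pow_add d p)
    clear hd
    induction p with
    | zero => simp
    | succ p ih =>
      rw [Nat.ascFactorial_succ, Nat.ascFactorial_succ]
      exact Nat.mul_le_mul (by omega) ih
  have h2 : (d.ascFactorial p : ℝ) ≤ ((d : ℝ) + p) ^ p := by exact_mod_cast h1
  refine h2.trans ?_
  have h3 := one_add_pow_le' p (p / d) (by positivity)
    (by rw [div_le_one hd0]; exact_mod_cast (by omega : p ≤ d))
  have : (d : ℝ) + p = d * (1 + p / d) := by field_simp
  rw [this, mul_pow]
  apply mul_le_mul_of_nonneg_left _ (by positivity)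
  rw [mul_div_assoc]; exact h3

theorem desc_ge_real (p : ℕ) (d : ℕ) (hd : p + 1 ≤ d) :
    (d : ℝ) ^ p * (1 - p * p / d) ≤ (d.descFactorial p : ℝ) := by
  have hd0 : (0 : ℝ) < d := by exact_mod_cast (by omega : 0 < d)
  have hp : (p : ℝ) / d ≤ 1 := by rw [div_le_one hd0]; exact_mod_cast (by omega : p ≤ d)
  have h1 : (d - p) ^ p ≤ d.descFactorial p :=
    (Nat.pow_le_pow_left (by omega) p).trans (Nat.pow_sub_le_descFactorial d p)
  have h2 : ((d : ℝ) - p) ^ p ≤ (d.descFactorial p : ℝ) := by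
    rw [← Nat.cast_sub (by omega)]; exact_mod_cast h1
  refine le_trans ?_ h2
  have h3 := one_add_mul_le_pow (a := -((p : ℝ) / d)) (by linarith) p
  have : (d : ℝ) - p = d * (1 + -(p / d)) := by field_simp; ring
  rw [this, mul_pow]
  apply mul_le_mul_of_nonneg_left _ (by positivity)
  refine le_trans (le_of_eq ?_) h3
  ring

theorem nonSqfree_card_le (p : ℕ) (d : ℕ) (hd : p + 1 ≤ d) :
    (p.factorial : ℝ) * (nonSqfree (Fin d) p).card ≤ (d : ℝ) ^ p * ((2 ^ p * p + p * p) / d) := by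
  have h := card_nonSqfree (Fin d) p
  rw [Fintype.card_fin] at h
  have h' : (p.factorial : ℝ) * (nonSqfree (Fin d) p).card + d.descFactorial p
    = d.ascFactorial p := by exact_mod_cast h
  have h1 := asc_le_real p d hd
  have h2 := desc_ge_real p d hd
  have : (d : ℝ) ^ p * ((2 ^ p * p + p * p) / d) =
    (d : ℝ) ^ p * (1 + 2 ^ p * p / d) - (d : ℝ) ^ p * (1 - p * p / d) := by ring
  linarith

theorem one_add_mul_le (A B d : ℝ) (hA : 0 ≤ A) (hB : 0 ≤ B) (hd : 1 ≤ d) :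
    (1 + A / d) * (1 + B / d) ≤ 1 + (A + B + A * B) / d := by
  have hd0 : 0 < d := by linarith
  have : A * B / (d * d) ≤ A * B / d := by
    apply div_le_div_of_nonneg_left (by positivity) hd0
    nlinarith
  have e : (1 + A / d) * (1 + B / d) = 1 + (A + B) / d + A * B / (d * d) := by
    field_simp
    ring
  rw [e, add_div (A + B)]; linarith

theorem step_real (p κ : ℕ) (b C1 : ℝ) (hb : 0 ≤ b) (hC1 : 0 ≤ C1) :
    ∃ C : ℝ, 0 ≤ C ∧ ∃ D : ℕ, ∀ d : ℕ, D ≤ d → ∀ (e : ℕ) (X Y B : ℝ),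
      X ≤ 1 / ((d : ℝ) - κ) ^ p * Y + p.factorial * (nonSqfree (Fin d) p).card * B →
      0 ≤ Y → Y ≤ (1 + C1 / d) / (d : ℝ) ^ e → B ≤ b / (d : ℝ) ^ (e + 2 * p) →
      X ≤ (1 + C / d) / (d : ℝ) ^ (e + p) := by
  obtain ⟨C2, hC2, D, hD⟩ := inv_sub_pow_le p κ
  set M : ℝ := 2 ^ p * p + p * p with hM
  have hM0 : 0 ≤ M := by positivity
  refine ⟨C2 + C1 + C2 * C1 + M * b, by positivity, max D (p + 1), fun d hd e X Y B hX hY0 hY hB => ?_⟩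
  have h1 := (hD d (le_trans (le_max_left _ _) hd)).2
  have hdp : p + 1 ≤ d := le_trans (le_max_right _ _) hd
  have h2 := nonSqfree_card_le p d hdp
  have hd1 : (1 : ℝ) ≤ d := by exact_mod_cast (by omega : 1 ≤ d)
  have hd0 : (0 : ℝ) < d := by linarith
  have t1 : 1 / ((d : ℝ) - κ) ^ p * Y ≤ (1 + C2 / d) / (d : ℝ) ^ p * ((1 + C1 / d) / (d : ℝ) ^ e) :=
    mul_le_mul h1 hY hY0 (by positivity)
  have t2 : (p.factorial : ℝ) * (nonSqfree (Fin d) p).card * B ≤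
      (d : ℝ) ^ p * (M / d) * (b / (d : ℝ) ^ (e + 2 * p)) :=
    (mul_le_mul_of_nonneg_left hB (by positivity)).trans
      (mul_le_mul_of_nonneg_right h2 (by positivity))
  have t3 := one_add_mul_le C2 C1 d hC2 hC1 hd1
  have e1 : (1 + C2 / d) / (d : ℝ) ^ p * ((1 + C1 / d) / (d : ℝ) ^ e) =
      ((1 + C2 / d) * (1 + C1 / d)) / (d : ℝ) ^ (e + p) := by
    rw [pow_add]; field_simp
  have e2 : (d : ℝ) ^ p * (M / d) * (b / (d : ℝ) ^ (e + 2 * p)) = (M * b / d) / (d : ℝ) ^ (e + p) := by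
    rw [two_mul, pow_add, pow_add, pow_add]; field_simp
  rw [e1] at t1
  rw [e2] at t2
  refine hX.trans ((add_le_add t1 t2).trans ?_)
  rw [← add_div]
  apply div_le_div_of_nonneg_right _ (by positivity)
  have e3 : (C2 + C1 + C2 * C1 + M * b) / (d : ℝ) = (C2 + C1 + C2 * C1) / d + M * b / d := add_div _ _ _
  rw [e3]
  linarith

theorem final_upper (p κ : ℕ) (C1 : ℝ) (hC1 : 0 ≤ C1) :
    ∃ C : ℝ, 0 ≤ C ∧ ∃ D : ℕ, ∀ d : ℕ, D ≤ d → ∀ (X Y : ℝ),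
      X ≤ p.factorial / ((d : ℝ) - κ) ^ p * Y →
      0 ≤ Y → Y ≤ (1 + C1 / d) / (d : ℝ) ^ (2 * p) →
      X ≤ p.factorial / (d : ℝ) ^ (3 * p) + C / (d : ℝ) ^ (3 * p + 1) := by
  obtain ⟨C2, hC2, D, hD⟩ := inv_sub_pow_le p κ
  refine ⟨p.factorial * (C2 + C1 + C2 * C1), by positivity, max D 1, fun d hd X Y hX hY0 hY => ?_⟩
  have h1 := (hD d (le_trans (le_max_left _ _) hd)).2
  have hdp : 1 ≤ d := le_trans (le_max_right _ _) hd
  have hd1 : (1 : ℝ) ≤ d := by exact_mod_cast hdp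
  have hd0 : (0 : ℝ) < d := by linarith
  have t1 : 1 / ((d : ℝ) - κ) ^ p * Y ≤ (1 + C2 / d) / (d : ℝ) ^ p * ((1 + C1 / d) / (d : ℝ) ^ (2 * p)) :=
    mul_le_mul h1 hY hY0 (by positivity)
  have t3 := one_add_mul_le C2 C1 d hC2 hC1 hd1
  have e1 : (1 + C2 / d) / (d : ℝ) ^ p * ((1 + C1 / d) / (d : ℝ) ^ (2 * p)) =
      ((1 + C2 / d) * (1 + C1 / d)) / (d : ℝ) ^ (3 * p) := by
    rw [show 3 * p = p + 2 * p by ring, pow_add]; field_simp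
  rw [e1] at t1
  have t4 := t1.trans (div_le_div_of_nonneg_right t3 (by positivity))
  have t5 := mul_le_mul_of_nonneg_left t4 (by positivity : (0 : ℝ) ≤ p.factorial)
  refine hX.trans (le_trans (le_of_eq (by ring)) (t5.trans (le_of_eq ?_)))
  rw [pow_succ]; field_simp

theorem final_lower (p : ℕ) (C1 : ℝ) (hC1 : 0 ≤ C1) :
    ∃ C : ℝ, 0 ≤ C ∧ ∃ D : ℕ, ∀ d : ℕ, D ≤ d → ∀ (X x : ℝ),
      p.factorial / ((d : ℝ) + p) ^ p * x ^ p ≤ X →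
      (1 - C1 / d) / (d : ℝ) ^ 2 ≤ x →
      p.factorial / (d : ℝ) ^ (3 * p) - C / (d : ℝ) ^ (3 * p + 1) ≤ X := by
  refine ⟨p.factorial * (p * p + p * C1), by positivity, max (⌈C1⌉₊ + 1) (p + 1),
    fun d hd X x hX hx => ?_⟩
  have hdp : p + 1 ≤ d := le_trans (le_max_right _ _) hd
  have hdc : C1 ≤ d := (Nat.le_ceil C1).trans (by
    exact_mod_cast (le_trans (Nat.le_succ _) (le_trans (le_max_left _ _) hd)))
  have hd0 : (0 : ℝ) < d := by exact_mod_cast (by omega : 0 < d)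
  have hpd : (p : ℝ) / d ≤ 1 := by rw [div_le_one hd0]; exact_mod_cast (by omega : p ≤ d)
  have hcd : C1 / d ≤ 1 := by rw [div_le_one hd0]; exact hdc
  have hx0 : 0 ≤ (1 - C1 / d) / (d : ℝ) ^ 2 := div_nonneg (by linarith) (by positivity)
  have h1 := one_add_mul_le_pow (a := -((p : ℝ) / d)) (by linarith) p
  have h2 := one_add_mul_le_pow (a := -(C1 / d)) (by linarith) p
  have h3 : ((1 + -((p : ℝ) / d)) / d) ^ p ≤ 1 / ((d : ℝ) + p) ^ p := by
    rw [← one_div_pow]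
    apply pow_le_pow_left₀ (div_nonneg (by linarith) hd0.le)
    rw [div_le_div_iff₀ hd0 (by positivity)]
    have : (1 + -((p : ℝ) / d)) * (d + p) = d - p * p / d := by field_simp; ring
    rw [this]
    have : (0 : ℝ) ≤ p * p / d := by positivity
    linarith
  have h4 : ((1 - C1 / d) / (d : ℝ) ^ 2) ^ p ≤ x ^ p := pow_le_pow_left₀ hx0 hx p
  have h5 : ((1 + -((p : ℝ) / d)) / d) ^ p * ((1 - C1 / d) / (d : ℝ) ^ 2) ^ p ≤
      1 / ((d : ℝ) + p) ^ p * x ^ p := mul_le_mul h3 h4 (by positivity) (by positivity)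
  have h6 : 1 - (p * p + p * C1) / d ≤ (1 + -((p : ℝ) / d)) ^ p * (1 + -(C1 / d)) ^ p := by
    have a1 : (1 + -((p : ℝ) / d)) ^ p ≤ 1 := pow_le_one₀ (by linarith) (by
      have : 0 ≤ (p : ℝ) / d := by positivity
      linarith)
    have a2 : (1 + -(C1 / d)) ^ p ≤ 1 := pow_le_one₀ (by linarith) (by
      have : 0 ≤ C1 / d := by positivity
      linarith)
    have e : (p * p + p * C1) / (d : ℝ) = p * (p / d) + p * (C1 / d) := by ring
    rw [e]
    nlinarith
  have h7 : ((1 + -((p : ℝ) / d)) / d) ^ p * ((1 - C1 / d) / (d : ℝ) ^ 2) ^ p =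
      ((1 + -((p : ℝ) / d)) ^ p * (1 + -(C1 / d)) ^ p) / (d : ℝ) ^ (3 * p) := by
    rw [div_pow, div_pow, ← pow_mul, div_mul_div_comm, ← pow_add,
      show p + 2 * p = 3 * p by ring, ← sub_eq_add_neg, ← sub_eq_add_neg]
  rw [h7] at h5
  have h8 := (div_le_div_of_nonneg_right h6 (by positivity : (0 : ℝ) ≤ (d : ℝ) ^ (3 * p))).trans h5
  have h9 := mul_le_mul_of_nonneg_left h8 (by positivity : (0 : ℝ) ≤ p.factorial)
  refine le_trans (le_of_eq ?_) (h9.trans (le_trans (le_of_eq (by ring)) hX))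
  rw [pow_succ]; field_simp

end RealAsymp

open MeasureTheory

section Case1Upper

open Finset

theorem mono3_le (x y z : ℝ) (hx : 0 ≤ x) (hy : 0 ≤ y) (hz : 0 ≤ z) (i j t : ℕ) :
    x ^ i * y ^ j * z ^ t ≤ x ^ (i + j + t) + y ^ (i + j + t) + z ^ (i + j + t) := by
  set M := max x (max y z)
  have h1 : x ≤ M := le_max_left _ _
  have h2 : y ≤ M := (le_max_left _ _).trans (le_max_right _ _)
  have h3 : z ≤ M := (le_max_right _ _).trans (le_max_right _ _)
  have hM : 0 ≤ M := hx.trans h1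
  have h : x ^ i * y ^ j * z ^ t ≤ M ^ (i + j + t) := by
    rw [pow_add, pow_add]
    gcongr
  refine h.trans ?_
  have a1 : 0 ≤ x ^ (i + j + t) := by positivity
  have a2 : 0 ≤ y ^ (i + j + t) := by positivity
  have a3 : 0 ≤ z ^ (i + j + t) := by positivity
  rcases max_choice x (max y z) with e | e
  · have : M = x := e
    rw [this]; linarith
  · rcases max_choice y z with e' | e'
    · have : M = y := e.trans e'
      rw [this]; linarith
    · have : M = z := e.trans e'
      rw [this]; linarith

theorem sum_subset_norm {d : ℕ} (Ψ : Matrix.unitaryGroup (Fin d) ℂ) (j k : Fin d) :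
    ‖ent Ψ j k‖ ^ 2 = sqn Ψ j k := rfl

theorem norm_conj_ent {d : ℕ} (Ψ : Matrix.unitaryGroup (Fin d) ℂ) (j k : Fin d) :
    ‖(starRingEnd ℂ) (ent Ψ j k)‖ ^ 2 = sqn Ψ j k := by
  rw [RCLike.norm_conj]; rfl

theorem sqn_le_one {d : ℕ} (Ψ : Matrix.unitaryGroup (Fin d) ℂ) (j k : Fin d) : sqn Ψ j k ≤ 1 := by
  rw [← sqn_sum_row Ψ k]
  exact single_le_sum (f := fun j => sqn Ψ j k) (fun i _ => sqn_nonneg _ _ _) (mem_univ j)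

section
variable {d : ℕ} [MeasurableSpace (Matrix.unitaryGroup (Fin d) ℂ)]
  [BorelSpace (Matrix.unitaryGroup (Fin d) ℂ)]

theorem mom3_le {P : Measure (Matrix.unitaryGroup (Fin d) ℂ)} (hP : IsHaarU P)
    (r k l m : Fin d) (i j t s : ℕ) (hs : i + j + t = s) :
    ∫ Ψ, sqn Ψ r k ^ i * sqn Ψ r l ^ j * sqn Ψ r m ^ t ∂P ≤ 3 * s.factorial / (d : ℝ) ^ s := by
  subst hs
  have h1 : ∫ Ψ, sqn Ψ r k ^ i * sqn Ψ r l ^ j * sqn Ψ r m ^ t ∂P ≤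
      ∫ Ψ, (sqn Ψ r k ^ (i + j + t) + sqn Ψ r l ^ (i + j + t) + sqn Ψ r m ^ (i + j + t)) ∂P := by
    apply integral_mono (hP.integrable (by fun_prop)) (hP.integrable (by fun_prop))
    intro Ψ
    exact mono3_le _ _ _ (sqn_nonneg _ _ _) (sqn_nonneg _ _ _) (sqn_nonneg _ _ _) _ _ _
  rw [integral_add (hP.integrable (by fun_prop)) (hP.integrable (by fun_prop)),
    integral_add (hP.integrable (by fun_prop)) (hP.integrable (by fun_prop))] at h1
  have a := sqn_moment_le hP (i + j + t) r k
  have b := sqn_moment_le hP (i + j + t) r l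
  have c := sqn_moment_le hP (i + j + t) r m
  refine h1.trans ((add_le_add (add_le_add a b) c).trans (le_of_eq ?_))
  ring

end

theorem T_bound (p : ℕ) (hp : p ≠ 0) : ∃ C : ℝ, 0 ≤ C ∧ ∃ D : ℕ, ∀ d : ℕ, D ≤ d →
    ∀ [MeasurableSpace (Matrix.unitaryGroup (Fin d) ℂ)]
      [BorelSpace (Matrix.unitaryGroup (Fin d) ℂ)]
      (P : Measure (Matrix.unitaryGroup (Fin d) ℂ)), IsHaarU P → ∀ k l : Fin d, k ≠ l →
      ∫ Ψ, (∑ j, sqn Ψ j k * sqn Ψ j l) ^ p ∂P ≤ (1 + C / d) / (d : ℝ) ^ p := by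
  obtain ⟨C, hC, D, hD⟩ := step_real p 1 (3 * (2 * p).factorial) 0 (by positivity) le_rfl
  refine ⟨C, hC, D, fun d hd _ _ P hP k l hkl => ?_⟩
  have := hP.prob
  have h := lemma_S hP p hp {k} l (by simpa using hkl.symm) (fun Ψ j => ent Ψ j k)
    (fun j => by fun_prop) (fun Ψ Φ h => by funext j; exact h j k (by simp))
    (3 * (2 * p).factorial / (d : ℝ) ^ (2 * p)) (fun j => by
      have := mom3_le hP j k l l p p 0 (2 * p) (by ring)
      simpa only [sum_subset_norm, mul_pow, pow_zero, mul_one] using this)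
  simp only [sum_subset_norm, sqn_sum_row, one_pow, integral_const, probReal_univ, one_smul,
    card_singleton] at h
  have := hD d hd 0 _ _ _ h zero_le_one (by simp) (by rw [zero_add])
  simpa using this

theorem S_bound (p : ℕ) (hp : p ≠ 0) : ∃ C : ℝ, 0 ≤ C ∧ ∃ D : ℕ, ∀ d : ℕ, D ≤ d →
    ∀ [MeasurableSpace (Matrix.unitaryGroup (Fin d) ℂ)]
      [BorelSpace (Matrix.unitaryGroup (Fin d) ℂ)]
      (P : Measure (Matrix.unitaryGroup (Fin d) ℂ)), IsHaarU P → ∀ k l m : Fin d, k ≠ l →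
      k ≠ m → l ≠ m →
      ∫ Ψ, (∑ j, sqn Ψ j k * sqn Ψ j l * sqn Ψ j m) ^ p ∂P ≤ (1 + C / d) / (d : ℝ) ^ (2 * p) := by
  obtain ⟨C1, hC1, D1, hD1⟩ := T_bound p hp
  obtain ⟨C, hC, D, hD⟩ := step_real p 2 (3 * (3 * p).factorial) C1 (by positivity) hC1
  refine ⟨C, hC, max D D1, fun d hd _ _ P hP k l m hkl hkm hlm => ?_⟩
  have h := lemma_S hP p hp {k, l} m (by simp [hkm.symm, hlm.symm])
    (fun Ψ j => (starRingEnd ℂ) (ent Ψ j k) * ent Ψ j l)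
    (fun j => by fun_prop) (fun Ψ Φ h => by
      funext j
      have h1 : ent Ψ j k = ent Φ j k := h j k (by simp)
      have h2 : ent Ψ j l = ent Φ j l := h j l (by simp)
      rw [h1, h2])
    (3 * (3 * p).factorial / (d : ℝ) ^ (3 * p)) (fun j => by
      have := mom3_le hP j k l m p p p (3 * p) (by ring)
      simpa only [norm_mul, sum_subset_norm, norm_conj_ent, mul_pow] using this)
  simp only [norm_mul, mul_pow, sum_subset_norm, norm_conj_ent, card_pair hkl] at h
  have := hD d (le_trans (le_max_left _ _) hd) p _ _ _ h
    (integral_nonneg fun Ψ => pow_nonneg (sum_nonneg fun j _ => mul_nonneg (sqn_nonneg _ _ _) (sqn_nonneg _ _ _)) _)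
    (hD1 d (le_trans (le_max_right _ _) hd) P hP k l hkl) (by rw [show p + 2 * p = 3 * p by ring])
  rwa [show p + p = 2 * p by ring] at this

end Case1Upper

open MeasureTheory

section Case2Upper

open Finset

theorem sqfreeIdx_le_one {ι : Type} [Fintype ι] [DecidableEq ι] {p : ℕ} {α : ι → ℕ}
    (h : α ∈ sqfreeIdx ι p) : ∀ j, α j ≤ 1 := (mem_filter.1 h).2

theorem sqfreeIdx_sum {ι : Type} [Fintype ι] [DecidableEq ι] {p : ℕ} {α : ι → ℕ}
    (h : α ∈ sqfreeIdx ι p) : ∑ j, α j = p := (mem_piAntidiag.1 (sqfreeIdx_subset h)).1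

/-- coefficients of `((a - x)^2)^e` for `e ≤ 1` -/
def vco (x : ℝ) (e : ℕ) (t : Fin 3) : ℝ :=
  if e = 0 then (if t = 0 then 1 else 0) else ![x ^ 2, -2 * x, 1] t

theorem vco_sum (x : ℝ) (e : ℕ) (he : e ≤ 1) (a : ℝ) :
    ((a - x) ^ 2) ^ e = ∑ t : Fin 3, vco x e t * a ^ (t : ℕ) := by
  rw [Fin.sum_univ_three]
  interval_cases e <;> simp [vco]
  ring

theorem vco_main (x : ℝ) (e : ℕ) (he : e ≤ 1) :
    ∑ t : Fin 3, vco x e t * ((t : ℕ).factorial * x ^ (t : ℕ)) = (x ^ 2) ^ e := by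
  rw [Fin.sum_univ_three]
  interval_cases e <;> simp [vco]
  ring

theorem vco_abs (x : ℝ) (hx : 0 ≤ x) (e : ℕ) (he : e ≤ 1) :
    ∑ t : Fin 3, |vco x e t| * ((t : ℕ).factorial * x ^ (t : ℕ)) = (5 * x ^ 2) ^ e := by
  rw [Fin.sum_univ_three]
  interval_cases e <;> simp [vco, abs_mul, abs_of_nonneg hx]
  ring

theorem vco_zero (x : ℝ) (e : ℕ) (t : Fin 3) (h : vco x e t ≠ 0) : (t : ℕ) ≤ 2 * e := by
  unfold vco at h
  split_ifs at h with h1 h2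
  · simp [h2]
  · exact absurd rfl h
  · have := t.2
    omega

theorem inv_asc_close (s q d : ℕ) (hs : s ≤ q) (hd : q + 1 ≤ d) :
    |1 / (d.ascFactorial s : ℝ) - (1 / (d : ℝ)) ^ s| ≤ (2 ^ q * q / d) * (1 / (d : ℝ)) ^ s := by
  have hd0 : (0 : ℝ) < d := by exact_mod_cast (by omega : 0 < d)
  have h1 : (d : ℝ) ^ s ≤ d.ascFactorial s := by
    exact_mod_cast Nat.pow_succ_le_ascFactorial d s
  have h2 := asc_le_real s d (by omega)
  have hpos : (0 : ℝ) < (d : ℝ) ^ s := by positivity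
  have hA : (0 : ℝ) < d.ascFactorial s := lt_of_lt_of_le hpos h1
  have hC : (2 : ℝ) ^ s * s / d ≤ 2 ^ q * q / d := by
    apply div_le_div_of_nonneg_right _ hd0.le
    have : (s : ℝ) ≤ q := by exact_mod_cast hs
    gcongr
    norm_num
  have h3 : (d.ascFactorial s : ℝ) ≤ (d : ℝ) ^ s * (1 + 2 ^ q * q / d) :=
    h2.trans (mul_le_mul_of_nonneg_left (by linarith) hpos.le)
  set c : ℝ := 2 ^ q * q / d
  have hc0 : 0 ≤ c := by positivity
  rw [one_div_pow, abs_sub_comm, abs_of_nonneg]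
  · rw [sub_le_iff_le_add, ← sub_le_iff_le_add']
    have : 1 / (d : ℝ) ^ s - c * (1 / (d : ℝ) ^ s) = (1 - c) / (d : ℝ) ^ s := by ring
    rw [this, div_le_div_iff₀ hpos hA]
    by_cases h : c ≤ 1
    · calc (1 - c) * (d.ascFactorial s : ℝ) ≤ (1 - c) * ((d : ℝ) ^ s * (1 + c)) :=
            mul_le_mul_of_nonneg_left h3 (by linarith)
        _ = (1 - c * c) * (d : ℝ) ^ s := by ring
        _ ≤ _ := mul_le_mul_of_nonneg_right (by nlinarith) hpos.le
    · have : (1 - c) * (d.ascFactorial s : ℝ) ≤ 0 :=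
        mul_nonpos_of_nonpos_of_nonneg (by linarith) hA.le
      linarith
  · rw [sub_nonneg]
    exact one_div_le_one_div_of_le hpos h1

theorem sqfree_term {d : ℕ} [MeasurableSpace (Matrix.unitaryGroup (Fin d) ℂ)]
    [BorelSpace (Matrix.unitaryGroup (Fin d) ℂ)]
    {P : Measure (Matrix.unitaryGroup (Fin d) ℂ)} (hP : IsHaarU P) (p : ℕ) (hd : 2 * p + 1 ≤ d)
    (k : Fin d) (α : Fin d → ℕ) (hα1 : ∀ j, α j ≤ 1) (hαs : ∑ j, α j = p) :
    ∫ Ψ, ∏ j, ((sqn Ψ j k - 1 / (d : ℝ)) ^ 2) ^ α j ∂P ≤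
      (1 + (2 ^ (2 * p) * (2 * p : ℕ) * 5 ^ p) / d) / (d : ℝ) ^ (2 * p) := by
  have hd0 : (0 : ℝ) < d := by exact_mod_cast (by omega : 0 < d)
  set x : ℝ := 1 / d with hx
  have hx0 : 0 ≤ x := by positivity
  set c : ℝ := 2 ^ (2 * p) * (2 * p : ℕ) / d with hc
  have e1 : ∀ Ψ : Matrix.unitaryGroup (Fin d) ℂ, ∏ j, ((sqn Ψ j k - x) ^ 2) ^ α j =
      ∑ f : Fin d → Fin 3, (∏ j, vco x (α j) (f j)) * ∏ j, sqn Ψ j k ^ (f j : ℕ) := by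
    intro Ψ
    have := (Finset.prod_univ_sum (fun _ : Fin d => (univ : Finset (Fin 3)))
      (fun j t => vco x (α j) t * sqn Ψ j k ^ (t : ℕ)))
    rw [Fintype.piFinset_univ] at this
    simp_rw [vco_sum x _ (hα1 _)]
    rw [this]
    simp_rw [prod_mul_distrib]
  simp_rw [e1]
  rw [integral_finsetSum _ (fun f _ => hP.integrable (by fun_prop))]
  simp_rw [integral_const_mul]
  have e2 : ∀ f : Fin d → Fin 3, ∫ Ψ, ∏ j, sqn Ψ j k ^ (f j : ℕ) ∂P =
      (∏ j, ((f j : ℕ).factorial : ℝ)) * (1 / (d.ascFactorial (∑ j, (f j : ℕ)) : ℝ)) := by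
    intro f
    have := row_moment hP (∑ j, (f j : ℕ)) k (fun j => (f j : ℕ)) (by simp [mem_piAntidiag])
    rw [mul_one_div]
    push_cast at this
    exact this
  simp_rw [e2]
  have e3 : ∀ f : Fin d → Fin 3, (∏ j, vco x (α j) (f j)) *
      ((∏ j, ((f j : ℕ).factorial : ℝ)) * (1 / (d.ascFactorial (∑ j, (f j : ℕ)) : ℝ))) ≤
      ∏ j, vco x (α j) (f j) * (((f j : ℕ).factorial : ℝ) * x ^ (f j : ℕ)) +
      c * ∏ j, |vco x (α j) (f j)| * (((f j : ℕ).factorial : ℝ) * x ^ (f j : ℕ)) := by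
    intro f
    simp only [prod_mul_distrib, ← abs_prod, prod_pow_eq_pow_sum]
    by_cases h0 : ∏ j, vco x (α j) (f j) = 0
    · simp [h0]
    have hle : ∑ j, (f j : ℕ) ≤ 2 * p := by
      rw [← hαs, mul_sum]
      apply sum_le_sum; intro j _
      exact vco_zero x _ _ (fun h => h0 (prod_eq_zero (mem_univ j) h))
    have hcl := inv_asc_close _ (2 * p) d hle hd
    rw [← hx, ← hc] at hcl
    set V := ∏ j, vco x (α j) (f j)
    have hF : (0 : ℝ) ≤ ∏ j, ((f j : ℕ).factorial : ℝ) := by positivity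
    set F := ∏ j, ((f j : ℕ).factorial : ℝ)
    set Q := 1 / (d.ascFactorial (∑ j, (f j : ℕ)) : ℝ)
    set R := x ^ (∑ j, (f j : ℕ))
    have : V * F * (Q - R) ≤ |V| * F * (c * R) := by
      calc V * F * (Q - R) ≤ |V * F * (Q - R)| := le_abs_self _
        _ = |V| * F * |Q - R| := by rw [abs_mul, abs_mul, abs_of_nonneg hF]
        _ ≤ _ := mul_le_mul_of_nonneg_left hcl (by positivity)
    linarith
  refine (sum_le_sum fun f _ => e3 f).trans (le_of_eq ?_)
  rw [sum_add_distrib, ← mul_sum]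
  have s1 := (Finset.prod_univ_sum (fun _ : Fin d => (univ : Finset (Fin 3)))
      (fun j t => vco x (α j) t * (((t : ℕ).factorial : ℝ) * x ^ (t : ℕ))))
  have s2 := (Finset.prod_univ_sum (fun _ : Fin d => (univ : Finset (Fin 3)))
      (fun j t => |vco x (α j) t| * (((t : ℕ).factorial : ℝ) * x ^ (t : ℕ))))
  rw [Fintype.piFinset_univ] at s1 s2
  rw [← s1, ← s2]
  simp_rw [vco_main x _ (hα1 _), vco_abs x hx0 _ (hα1 _)]
  rw [prod_pow_eq_pow_sum, prod_pow_eq_pow_sum, hαs, hc, hx, mul_pow, one_div_pow, one_div_pow,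
    ← pow_mul]
  field_simp

theorem V_bound (p : ℕ) (hp : p ≠ 0) : ∃ C : ℝ, 0 ≤ C ∧ ∃ D : ℕ, ∀ d : ℕ, D ≤ d →
    ∀ [MeasurableSpace (Matrix.unitaryGroup (Fin d) ℂ)]
      [BorelSpace (Matrix.unitaryGroup (Fin d) ℂ)]
      (P : Measure (Matrix.unitaryGroup (Fin d) ℂ)), IsHaarU P → ∀ k : Fin d,
      ∫ Ψ, (∑ j, (sqn Ψ j k - 1 / (d : ℝ)) ^ 2) ^ p ∂P ≤ (1 + C / d) / (d : ℝ) ^ p := by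
  set C1 : ℝ := 2 ^ (2 * p) * (2 * p : ℕ) * 5 ^ p with hC1d
  have hC1 : 0 ≤ C1 := by positivity
  obtain ⟨C, hC, D, hD⟩ := step_real p 0 ((2 * p).factorial + 1) C1 (by positivity) hC1
  refine ⟨C, hC, max D (2 * p + 1), fun d hd _ _ P hP k => ?_⟩
  have := hP.prob
  have hdp : 2 * p + 1 ≤ d := le_trans (le_max_right _ _) hd
  have hd0 : (0 : ℝ) < d := by exact_mod_cast (by omega : 0 < d)
  have hs : ∀ j, Continuous fun Ψ : Matrix.unitaryGroup (Fin d) ℂ =>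
    (sqn Ψ j k - 1 / (d : ℝ)) ^ 2 := fun j => by fun_prop
  have hs0 : ∀ (Ψ : Matrix.unitaryGroup (Fin d) ℂ) j, 0 ≤ (sqn Ψ j k - 1 / (d : ℝ)) ^ 2 :=
    fun Ψ j => sq_nonneg _
  have hB := nonSqfree_moment_le hP p hp _ hs hs0 (((2 * p).factorial + 1) / (d : ℝ) ^ (2 * p))
    (fun j => by
      have h1 : ∫ Ψ, ((sqn Ψ j k - 1 / (d : ℝ)) ^ 2) ^ p ∂P ≤
          ∫ Ψ, (sqn Ψ j k ^ (2 * p) + (1 / (d : ℝ)) ^ (2 * p)) ∂P := by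
        apply integral_mono (hP.integrable (by fun_prop)) (hP.integrable (by fun_prop))
        intro Ψ
        have h0 := sqn_nonneg Ψ j k
        have hx0 : 0 ≤ 1 / (d : ℝ) := by positivity
        dsimp only
        rw [← pow_mul, ← (even_two_mul p).pow_abs]
        rcases abs_cases (sqn Ψ j k - 1 / (d : ℝ)) with h | h
        · have : |sqn Ψ j k - 1 / (d : ℝ)| ^ (2 * p) ≤ sqn Ψ j k ^ (2 * p) :=
            pow_le_pow_left₀ (abs_nonneg _) (by linarith) _
          have : 0 ≤ (1 / (d : ℝ)) ^ (2 * p) := by positivity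
          linarith
        · have : |sqn Ψ j k - 1 / (d : ℝ)| ^ (2 * p) ≤ (1 / (d : ℝ)) ^ (2 * p) :=
            pow_le_pow_left₀ (abs_nonneg _) (by linarith) _
          have : 0 ≤ sqn Ψ j k ^ (2 * p) := by positivity
          linarith
      rw [integral_add (hP.integrable (by fun_prop)) (hP.integrable (by fun_prop))] at h1
      simp only [integral_const, probReal_univ, one_smul] at h1
      have h2 := sqn_moment_le hP (2 * p) j k
      refine h1.trans ((add_le_add_left h2 _).trans (le_of_eq ?_))
      rw [one_div_pow, add_div])
  have hA : ∀ α ∈ sqfreeIdx (Fin d) p, ∫ Ψ, ∏ j, ((sqn Ψ j k - 1 / (d : ℝ)) ^ 2) ^ α j ∂P ≤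
      (1 + C1 / d) / (d : ℝ) ^ (2 * p) := fun α hα =>
    sqfree_term hP p hdp k α (sqfreeIdx_le_one hα) (sqfreeIdx_sum hα)
  have hmain : ∫ Ψ, (∑ j, (sqn Ψ j k - 1 / (d : ℝ)) ^ 2) ^ p ∂P ≤
      ∫ Ψ, ((p.factorial : ℝ) * ∑ α ∈ sqfreeIdx (Fin d) p, ∏ j, ((sqn Ψ j k - 1 / (d : ℝ)) ^ 2) ^ α j +
        (p.factorial : ℝ) * ∑ α ∈ nonSqfree (Fin d) p, ∏ j, ((sqn Ψ j k - 1 / (d : ℝ)) ^ 2) ^ α j) ∂P := by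
    apply integral_mono (hP.integrable (by fun_prop)) (hP.integrable (by fun_prop))
    intro Ψ
    dsimp only
    rw [sum_pow_eq_sum_piAntidiag, sum_split, mul_sum, mul_sum]
    apply add_le_add
    · apply sum_le_sum; intro α hα
      rw [multinomial_sqfree hα]
    · apply sum_le_sum; intro α hα
      have : (Nat.multinomial univ α : ℝ) ≤ p.factorial := by
        exact_mod_cast multinomial_le (nonSqfree_subset hα)
      exact mul_le_mul_of_nonneg_right this (prod_nonneg fun j _ => pow_nonneg (hs0 Ψ j) _)
  rw [integral_add (hP.integrable (by fun_prop)) (hP.integrable (by fun_prop)),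
    integral_const_mul, integral_const_mul,
    integral_finsetSum (sqfreeIdx (Fin d) p) (fun f _ => hP.integrable (by fun_prop))] at hmain
  have hA2 := sum_le_card_nsmul _ _ _ hA
  rw [nsmul_eq_mul, card_sqfree, Fintype.card_fin] at hA2
  have hch : (p.factorial : ℝ) * (d.choose p : ℝ) ≤ (d : ℝ) ^ p := by
    have := Nat.descFactorial_le_pow d p
    rw [Nat.descFactorial_eq_factorial_mul_choose] at this
    exact_mod_cast this
  have hY : (0 : ℝ) ≤ 1 + C1 / d := by positivity
  have hA3 : (p.factorial : ℝ) * ∑ α ∈ sqfreeIdx (Fin d) p,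
      ∫ Ψ, ∏ j, ((sqn Ψ j k - 1 / (d : ℝ)) ^ 2) ^ α j ∂P ≤
      1 / ((d : ℝ) - (0 : ℕ)) ^ p * (1 + C1 / d) := by
    calc _ ≤ (p.factorial : ℝ) * ((d.choose p : ℝ) * ((1 + C1 / d) / (d : ℝ) ^ (2 * p))) :=
          mul_le_mul_of_nonneg_left hA2 (by positivity)
      _ = (p.factorial : ℝ) * (d.choose p : ℝ) * ((1 + C1 / d) / (d : ℝ) ^ (2 * p)) := by ring
      _ ≤ (d : ℝ) ^ p * ((1 + C1 / d) / (d : ℝ) ^ (2 * p)) :=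
          mul_le_mul_of_nonneg_right hch (by positivity)
      _ = _ := by
          rw [Nat.cast_zero, sub_zero, two_mul, pow_add]; field_simp
  have hB3 := mul_le_mul_of_nonneg_left hB (by positivity : (0 : ℝ) ≤ p.factorial)
  have hX := hmain.trans (add_le_add hA3 hB3)
  rw [← mul_assoc (p.factorial : ℝ)] at hX
  have := hD d (le_trans (le_max_left _ _) hd) 0 _ _ _ hX hY (by simp) (by rw [zero_add])
  simpa using this

theorem W_bound (p : ℕ) (hp : p ≠ 0) : ∃ C : ℝ, 0 ≤ C ∧ ∃ D : ℕ, ∀ d : ℕ, D ≤ d →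
    ∀ [MeasurableSpace (Matrix.unitaryGroup (Fin d) ℂ)]
      [BorelSpace (Matrix.unitaryGroup (Fin d) ℂ)]
      (P : Measure (Matrix.unitaryGroup (Fin d) ℂ)), IsHaarU P → ∀ k m : Fin d, k ≠ m →
      ∫ Ψ, (∑ j, (sqn Ψ j k - 1 / (d : ℝ)) ^ 2 * sqn Ψ j m) ^ p ∂P ≤
        (1 + C / d) / (d : ℝ) ^ (2 * p) := by
  obtain ⟨C1, hC1, D1, hD1⟩ := V_bound p hp
  obtain ⟨C, hC, D, hD⟩ := step_real p 1 (2 * (3 * p).factorial + 1) C1 (by positivity) hC1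
  refine ⟨C, hC, max D D1, fun d hd _ _ P hP k m hkm => ?_⟩
  have := hP.prob
  have hn : ∀ (Ψ : Matrix.unitaryGroup (Fin d) ℂ) j,
      ‖(((sqn Ψ j k - 1 / (d : ℝ) : ℝ)) : ℂ)‖ ^ 2 = (sqn Ψ j k - 1 / (d : ℝ)) ^ 2 := by
    intro Ψ j
    rw [Complex.norm_real, Real.norm_eq_abs, sq_abs]
  have h := lemma_S hP p hp {k} m (by simp [hkm.symm])
    (fun Ψ j => ((sqn Ψ j k - 1 / (d : ℝ) : ℝ) : ℂ))
    (fun j => by fun_prop) (fun Ψ Φ h => by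
      funext j
      have h1 : sqn Ψ j k = sqn Φ j k := by rw [sqn, sqn, h j k (by simp)]
      rw [h1])
    ((2 * (3 * p).factorial + 1) / (d : ℝ) ^ (3 * p)) (fun j => by
      simp only [hn]
      have hx0 : 0 ≤ 1 / (d : ℝ) := by positivity
      have h1 : ∫ Ψ, ((sqn Ψ j k - 1 / (d : ℝ)) ^ 2 * sqn Ψ j m) ^ p ∂P ≤
          ∫ Ψ, (sqn Ψ j k ^ (3 * p) + (1 / (d : ℝ)) ^ (3 * p) + sqn Ψ j m ^ (3 * p)) ∂P := by
        apply integral_mono (hP.integrable (by fun_prop)) (hP.integrable (by fun_prop))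
        intro Ψ
        have h0 := sqn_nonneg Ψ j k
        have h0' := sqn_nonneg Ψ j m
        dsimp only
        have hmx : |sqn Ψ j k - 1 / (d : ℝ)| ≤ max (sqn Ψ j k) (1 / d) := by
          rw [abs_le]
          have := le_max_left (sqn Ψ j k) (1 / (d : ℝ))
          have := le_max_right (sqn Ψ j k) (1 / (d : ℝ))
          constructor <;> linarith
        have h3 := mono3_le (max (sqn Ψ j k) (1 / (d : ℝ))) (sqn Ψ j m) 0
          (h0.trans (le_max_left _ _)) h0' le_rfl (2 * p) p 0
        have h4 : ((sqn Ψ j k - 1 / (d : ℝ)) ^ 2 * sqn Ψ j m) ^ p ≤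
            (max (sqn Ψ j k) (1 / (d : ℝ))) ^ (2 * p) * sqn Ψ j m ^ p := by
          rw [mul_pow, ← pow_mul, ← (even_two_mul p).pow_abs]
          exact mul_le_mul_of_nonneg_right (pow_le_pow_left₀ (abs_nonneg _) hmx _) (by positivity)
        have h5 : (max (sqn Ψ j k) (1 / (d : ℝ))) ^ (3 * p) ≤
            sqn Ψ j k ^ (3 * p) + (1 / (d : ℝ)) ^ (3 * p) := by
          have a1 : 0 ≤ sqn Ψ j k ^ (3 * p) := by positivity
          have a2 : 0 ≤ (1 / (d : ℝ)) ^ (3 * p) := by positivity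
          rcases max_choice (sqn Ψ j k) (1 / (d : ℝ)) with e | e <;> rw [e] <;> linarith
        rw [show 2 * p + p + 0 = 3 * p by ring, pow_zero, mul_one,
          zero_pow (by omega : 3 * p ≠ 0)] at h3
        linarith
      rw [integral_add (hP.integrable (by fun_prop)) (hP.integrable (by fun_prop)),
        integral_add (hP.integrable (by fun_prop)) (hP.integrable (by fun_prop))] at h1
      simp only [integral_const, probReal_univ, one_smul] at h1
      have h2 := sqn_moment_le hP (3 * p) j k
      have h2' := sqn_moment_le hP (3 * p) j m
      rw [one_div_pow] at h1
      have e : (2 * ((3 * p).factorial : ℝ) + 1) / (d : ℝ) ^ (3 * p) =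
        (3 * p).factorial / (d : ℝ) ^ (3 * p) + 1 / (d : ℝ) ^ (3 * p) +
        (3 * p).factorial / (d : ℝ) ^ (3 * p) := by ring
      rw [e]
      linarith)
  simp only [hn, card_singleton] at h
  have := hD d (le_trans (le_max_left _ _) hd) p _ _ _ h
    (integral_nonneg fun Ψ => pow_nonneg (sum_nonneg fun j _ => sq_nonneg _) _)
    (hD1 d (le_trans (le_max_right _ _) hd) P hP k) (by rw [show p + 2 * p = 3 * p by ring])
  rwa [show p + p = 2 * p by ring] at this

end Case2Upper

open MeasureTheory

section Lower

open Finset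

section
variable {d : ℕ} [MeasurableSpace (Matrix.unitaryGroup (Fin d) ℂ)]
  [BorelSpace (Matrix.unitaryGroup (Fin d) ℂ)]

theorem row_col {P : Measure (Matrix.unitaryGroup (Fin d) ℂ)} (hP : IsHaarU P)
    (K : Finset (Fin d)) (n j : Fin d) (hn : n ∉ K)
    (v : Matrix.unitaryGroup (Fin d) ℂ → ℂ) (hv : Continuous v)
    (hK : ∀ Ψ Φ : Matrix.unitaryGroup (Fin d) ℂ, (∀ j, ∀ k ∈ K, Ψ.1 j k = Φ.1 j k) → v Ψ = v Φ) :
    ((d - K.card : ℕ) : ℝ) * ∫ Ψ, ‖v Ψ‖ ^ 2 * sqn Ψ j n ∂P =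
      ∫ Ψ, (‖v Ψ‖ ^ 2 - ∑ r ∈ K, ‖v Ψ‖ ^ 2 * sqn Ψ j r) ∂P := by
  have h := column_moment hP 1 K n hn (fun Ψ i => if i = j then v Ψ else 0)
    (fun i => by by_cases h : i = j <;> simp only [h, if_true, if_false] <;> fun_prop)
    (fun Ψ Φ h => by rw [hK Ψ Φ h])
  have e1 : ∀ (Ψ : Matrix.unitaryGroup (Fin d) ℂ) r,
      ∑ i, (if i = j then v Ψ else 0) * Ψ.1 i r = v Ψ * ent Ψ j r := by
    intro Ψ r
    simp [ite_mul, ent_def]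
  have e2 : ∀ (Ψ : Matrix.unitaryGroup (Fin d) ℂ),
      ∑ i, ‖(if i = j then v Ψ else 0)‖ ^ 2 = ‖v Ψ‖ ^ 2 := by
    intro Ψ
    rw [sum_eq_single j]
    · simp
    · intro b _ hb; simp [hb]
    · simp
  simp only [e1, e2, norm_mul, mul_pow, mul_one, sum_subset_norm, pow_one, Nat.factorial_one,
    Nat.cast_one, one_mul] at h
  rw [h, Nat.ascFactorial_succ, Nat.ascFactorial_zero, mul_one, add_zero]

theorem w_bound {P : Measure (Matrix.unitaryGroup (Fin d) ℂ)} (hP : IsHaarU P)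
    (K : Finset (Fin d)) (n : Fin d) (hn : n ∉ K)
    (u : Matrix.unitaryGroup (Fin d) ℂ → Fin d → ℂ) (hu : ∀ j, Continuous fun Ψ => u Ψ j)
    (hK : ∀ Ψ Φ : Matrix.unitaryGroup (Fin d) ℂ, (∀ j, ∀ k ∈ K, Ψ.1 j k = Φ.1 j k) → u Ψ = u Φ)
    (hκ : 2 * K.card ≤ d) (c : ℝ) (hc : 0 ≤ c)
    (hb : ∀ j, ∫ Ψ, ‖u Ψ j‖ ^ 2 ∂P ≤ c / (d : ℝ) ^ 3) :
    ∫ Ψ, ‖∑ j, u Ψ j * ent Ψ j n‖ ^ 2 ∂P ≤ 2 * c / (d : ℝ) ^ 3 := by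
  have h := col_upper hP 1 K n hn u hu hK
  have hd0 : (0 : ℝ) < d := by exact_mod_cast n.pos
  simp only [mul_one, pow_one, Nat.factorial_one, Nat.cast_one] at h
  rw [integral_finsetSum _ (fun f _ => hP.integrable (by fun_prop))] at h
  have h2 := sum_le_card_nsmul univ _ _ (fun j _ => hb j)
  rw [card_univ, Fintype.card_fin, nsmul_eq_mul] at h2
  have hκ' : 2 * (K.card : ℝ) ≤ d := by exact_mod_cast hκ
  have hpos : (0 : ℝ) < d - K.card := by linarith
  have h3 : 1 / ((d : ℝ) - K.card) ≤ 2 / d := by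
    rw [div_le_div_iff₀ hpos hd0]; linarith
  refine h.trans ((mul_le_mul h3 h2 (sum_nonneg fun j _ => integral_nonneg fun Ψ => by positivity)
    (by positivity)).trans (le_of_eq ?_))
  field_simp

theorem E_ab {P : Measure (Matrix.unitaryGroup (Fin d) ℂ)} (hP : IsHaarU P) (hd : 2 ≤ d)
    (j k l : Fin d) (hkl : k ≠ l) :
    (1 - 2 / (d : ℝ)) / (d : ℝ) ^ 2 ≤ ∫ Ψ, sqn Ψ j k * sqn Ψ j l ∂P := by
  have hd2 : (2 : ℝ) ≤ d := by exact_mod_cast hd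
  have h := row_col hP {k} l j (by simpa using hkl.symm) (fun Ψ => ent Ψ j k) (by fun_prop)
    (fun Ψ Φ h => h j k (by simp))
  simp only [sum_subset_norm, sum_singleton, card_singleton] at h
  rw [integral_sub (hP.integrable (by fun_prop)) (hP.integrable (by fun_prop))] at h
  have h1 := sqn_moment hP 1 j k
  have h2 := sqn_moment_le hP 2 j k
  simp only [pow_one, Nat.factorial_one, Nat.cast_one, Nat.ascFactorial_succ, Nat.ascFactorial_zero,
    mul_one, add_zero] at h1
  simp only [sq (sqn _ _ _)] at h2
  rw [Nat.factorial_two] at h2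
  rw [h1, Nat.cast_sub (by omega)] at h
  have h0 : 0 ≤ ∫ Ψ, sqn Ψ j k * sqn Ψ j l ∂P :=
    integral_nonneg fun Ψ => mul_nonneg (sqn_nonneg _ _ _) (sqn_nonneg _ _ _)
  set E := ∫ Ψ, sqn Ψ j k * sqn Ψ j l ∂P
  have : (1 - 2 / (d : ℝ)) / (d : ℝ) ^ 2 * d ≤ E * d := by
    have e : (1 - 2 / (d : ℝ)) / (d : ℝ) ^ 2 * d = 1 / d - 2 / (d : ℝ) ^ 2 := by field_simp
    rw [e]
    push_cast at h h2
    linarith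
  exact le_of_mul_le_mul_right this (by linarith)

theorem E_abc {P : Measure (Matrix.unitaryGroup (Fin d) ℂ)} (hP : IsHaarU P) (hd : 4 ≤ d)
    (j k l m : Fin d) (hkl : k ≠ l) (hkm : k ≠ m) (hlm : l ≠ m) :
    (1 - 38 / (d : ℝ)) / (d : ℝ) ^ 3 ≤ ∫ Ψ, sqn Ψ j k * sqn Ψ j l * sqn Ψ j m ∂P := by
  have hd2 : (4 : ℝ) ≤ d := by exact_mod_cast hd
  have h := row_col hP {k, l} m j (by simp [hkm.symm, hlm.symm])
    (fun Ψ => ent Ψ j k * ent Ψ j l) (by fun_prop)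
    (fun Ψ Φ h => by
      have h1 : ent Ψ j k = ent Φ j k := h j k (by simp)
      have h2 : ent Ψ j l = ent Φ j l := h j l (by simp)
      rw [h1, h2])
  simp only [norm_mul, mul_pow, sum_subset_norm, sum_pair hkl, card_pair hkl] at h
  rw [integral_sub (hP.integrable (by fun_prop)) (hP.integrable (by fun_prop)),
    integral_add (hP.integrable (by fun_prop)) (hP.integrable (by fun_prop))] at h
  have h1 := E_ab hP (by omega) j k l hkl
  have h2 := mom3_le hP j k l k 1 1 1 3 rfl
  have h3 := mom3_le hP j k l l 1 1 1 3 rfl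
  simp only [pow_one] at h2 h3
  rw [show (3 : ℕ).factorial = 6 from rfl] at h2 h3
  rw [Nat.cast_sub (by omega)] at h
  have h0 : 0 ≤ ∫ Ψ, sqn Ψ j k * sqn Ψ j l * sqn Ψ j m ∂P :=
    integral_nonneg fun Ψ => mul_nonneg (mul_nonneg (sqn_nonneg _ _ _) (sqn_nonneg _ _ _)) (sqn_nonneg _ _ _)
  set E := ∫ Ψ, sqn Ψ j k * sqn Ψ j l * sqn Ψ j m ∂P
  have : (1 - 38 / (d : ℝ)) / (d : ℝ) ^ 3 * d ≤ E * d := by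
    have e : (1 - 38 / (d : ℝ)) / (d : ℝ) ^ 3 * d =
      (1 - 2 / (d : ℝ)) / (d : ℝ) ^ 2 - 18 / (d : ℝ) ^ 3 - 18 / (d : ℝ) ^ 3 := by field_simp; ring
    rw [e]
    push_cast at h h2 h3
    have e2 : (3 : ℝ) * 6 = 18 := by norm_num
    rw [e2] at h2 h3
    linarith
  exact le_of_mul_le_mul_right this (by linarith)

theorem lower_case1 {P : Measure (Matrix.unitaryGroup (Fin d) ℂ)} (hP : IsHaarU P) (hd : 4 ≤ d)
    (k l m : Fin d) (hkl : k ≠ l) (hkm : k ≠ m) (hlm : l ≠ m) :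
    (1 - 146 / (d : ℝ)) / (d : ℝ) ^ 2 ≤
    ∫ Ψ, (∑ j, ‖(starRingEnd ℂ) (ent Ψ j k) * ent Ψ j l * (starRingEnd ℂ) (ent Ψ j m)‖ ^ 2 -
      ∑ r ∈ {k, l, m}, ‖∑ j, ((starRingEnd ℂ) (ent Ψ j k) * ent Ψ j l *
        (starRingEnd ℂ) (ent Ψ j m)) * ent Ψ j r‖ ^ 2) ∂P := by
  have hd0 : (0 : ℝ) < d := by exact_mod_cast k.pos
  have key : ∀ (Ψ : Matrix.unitaryGroup (Fin d) ℂ), ∑ r ∈ {k, l, m}, ‖∑ j, ((starRingEnd ℂ) (ent Ψ j k) * ent Ψ j l *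
        (starRingEnd ℂ) (ent Ψ j m)) * ent Ψ j r‖ ^ 2 =
      ‖∑ j, ((starRingEnd ℂ) (ent Ψ j k) * ent Ψ j k * (starRingEnd ℂ) (ent Ψ j m)) * ent Ψ j l‖ ^ 2 +
      (‖∑ j, (ent Ψ j k * (starRingEnd ℂ) (ent Ψ j l) * (starRingEnd ℂ) (ent Ψ j l)) * ent Ψ j m‖ ^ 2 +
      ‖∑ j, ((starRingEnd ℂ) (ent Ψ j k) * (starRingEnd ℂ) (ent Ψ j m) * ent Ψ j m) * ent Ψ j l‖ ^ 2) := by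
    intro Ψ
    rw [sum_insert (by simp [hkl, hkm]), sum_pair hlm]
    congr 1
    · congr 2; apply sum_congr rfl; intro j _; ring
    · congr 1
      · rw [← RCLike.norm_conj, map_sum]
        congr 2; apply sum_congr rfl; intro j _
        simp only [map_mul, RingHomCompTriple.comp_apply, RingHom.id_apply]
        ring
      · congr 2; apply sum_congr rfl; intro j _; ring
  simp only [key]
  have e6 : (3 : ℝ) * ((3 : ℕ).factorial : ℝ) = 18 := by
    rw [show (3 : ℕ).factorial = 6 from rfl]; norm_num
  have b1 := w_bound hP {k, m} l (by simp [hkl.symm, hlm])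
    (fun Ψ j => (starRingEnd ℂ) (ent Ψ j k) * ent Ψ j k * (starRingEnd ℂ) (ent Ψ j m))
    (fun j => by fun_prop) (fun Ψ Φ h => by
      funext j
      have h1 : ent Ψ j k = ent Φ j k := h j k (by simp)
      have h2 : ent Ψ j m = ent Φ j m := h j m (by simp)
      rw [h1, h2]) (by rw [card_pair hkm]; omega) 18 (by norm_num) (fun j => by
      have := mom3_le hP j k k m 1 1 1 3 rfl
      rw [e6] at this
      simpa only [norm_mul, mul_pow, sum_subset_norm, norm_conj_ent, pow_one] using this)
  have b2 := w_bound hP {k, l} m (by simp [hkm.symm, hlm.symm])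
    (fun Ψ j => ent Ψ j k * (starRingEnd ℂ) (ent Ψ j l) * (starRingEnd ℂ) (ent Ψ j l))
    (fun j => by fun_prop) (fun Ψ Φ h => by
      funext j
      have h1 : ent Ψ j k = ent Φ j k := h j k (by simp)
      have h2 : ent Ψ j l = ent Φ j l := h j l (by simp)
      rw [h1, h2]) (by rw [card_pair hkl]; omega) 18 (by norm_num) (fun j => by
      have := mom3_le hP j k l l 1 1 1 3 rfl
      rw [e6] at this
      simpa only [norm_mul, mul_pow, sum_subset_norm, norm_conj_ent, pow_one] using this)
  have b3 := w_bound hP {k, m} l (by simp [hkl.symm, hlm])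
    (fun Ψ j => (starRingEnd ℂ) (ent Ψ j k) * (starRingEnd ℂ) (ent Ψ j m) * ent Ψ j m)
    (fun j => by fun_prop) (fun Ψ Φ h => by
      funext j
      have h1 : ent Ψ j k = ent Φ j k := h j k (by simp)
      have h2 : ent Ψ j m = ent Φ j m := h j m (by simp)
      rw [h1, h2]) (by rw [card_pair hkm]; omega) 18 (by norm_num) (fun j => by
      have := mom3_le hP j k m m 1 1 1 3 rfl
      rw [e6] at this
      simpa only [norm_mul, mul_pow, sum_subset_norm, norm_conj_ent, pow_one] using this)
  rw [integral_sub (hP.integrable (by fun_prop)) (hP.integrable (by fun_prop)),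
    integral_add (hP.integrable (by fun_prop)) (hP.integrable (by fun_prop)),
    integral_add (hP.integrable (by fun_prop)) (hP.integrable (by fun_prop)),
    integral_finsetSum _ (fun f _ => hP.integrable (by fun_prop))]
  have hS := card_nsmul_le_sum univ _ _ (fun j _ => E_abc hP hd j k l m hkl hkm hlm)
  rw [card_univ, Fintype.card_fin, nsmul_eq_mul] at hS
  simp only [norm_mul _ ((starRingEnd ℂ) (ent _ _ m)), norm_mul _ (ent _ _ l), mul_pow, sum_subset_norm, norm_conj_ent]
  have e : (1 - 146 / (d : ℝ)) / (d : ℝ) ^ 2 = d * ((1 - 38 / (d : ℝ)) / (d : ℝ) ^ 3) -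
    (2 * 18 / (d : ℝ) ^ 3 + (2 * 18 / (d : ℝ) ^ 3 + 2 * 18 / (d : ℝ) ^ 3)) := by field_simp; ring
  rw [e]
  linarith

end

end Lower

open MeasureTheory

section Lower2

open Finset

/-- centered squared modulus -/
noncomputable def csq {d : ℕ} (Ψ : Matrix.unitaryGroup (Fin d) ℂ) (j k : Fin d) : ℝ :=
  sqn Ψ j k - 1 / (d : ℝ)

@[fun_prop]
theorem cont_csq {d : ℕ} (j k : Fin d) :
    Continuous fun Ψ : Matrix.unitaryGroup (Fin d) ℂ => csq Ψ j k := by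
  unfold csq
  fun_prop

theorem norm_csq {d : ℕ} (Ψ : Matrix.unitaryGroup (Fin d) ℂ) (j k : Fin d) :
    ‖(csq Ψ j k : ℂ)‖ ^ 2 = csq Ψ j k ^ 2 := by
  rw [Complex.norm_real, Real.norm_eq_abs, sq_abs]

section
variable {d : ℕ} [MeasurableSpace (Matrix.unitaryGroup (Fin d) ℂ)]
  [BorelSpace (Matrix.unitaryGroup (Fin d) ℂ)]

theorem E_a {P : Measure (Matrix.unitaryGroup (Fin d) ℂ)} (hP : IsHaarU P) (j k : Fin d) :
    ∫ Ψ, sqn Ψ j k ∂P = 1 / (d : ℝ) := by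
  have h1 := sqn_moment hP 1 j k
  simpa only [pow_one, Nat.factorial_one, Nat.cast_one, Nat.ascFactorial_succ, Nat.ascFactorial_zero,
    mul_one, add_zero] using h1

theorem E_csq_sq {P : Measure (Matrix.unitaryGroup (Fin d) ℂ)} (hP : IsHaarU P) (j k : Fin d) :
    (1 - 2 / (d : ℝ)) / (d : ℝ) ^ 2 ≤ ∫ Ψ, csq Ψ j k ^ 2 ∂P := by
  have := hP.prob
  have hd0 : (0 : ℝ) < d := by exact_mod_cast k.pos
  have e : ∀ Ψ : Matrix.unitaryGroup (Fin d) ℂ, csq Ψ j k ^ 2 =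
      sqn Ψ j k ^ 2 - (2 / (d : ℝ)) * sqn Ψ j k + (1 / (d : ℝ)) ^ 2 := by
    intro Ψ; unfold csq; ring
  simp only [e]
  rw [integral_add (hP.integrable (by fun_prop)) (hP.integrable (by fun_prop)),
    integral_sub (hP.integrable (by fun_prop)) (hP.integrable (by fun_prop)), integral_const_mul,
    E_a hP, sqn_moment hP 2]
  simp only [integral_const, probReal_univ, one_smul, Nat.ascFactorial_succ, Nat.ascFactorial_zero,
    mul_one, add_zero, Nat.factorial_two]
  push_cast
  have h : 2 / (d : ℝ) ^ 2 - 2 / (d : ℝ) ^ 3 ≤ 2 / (((d : ℝ) + 1) * d) := by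
    have e1 : 2 / (d : ℝ) ^ 2 - 2 / (d : ℝ) ^ 3 = 2 * (d - 1) / (d : ℝ) ^ 3 := by field_simp
    rw [e1, div_le_div_iff₀ (by positivity) (by positivity)]
    have : 2 * (d : ℝ) ^ 3 - 2 * (d - 1) * ((d + 1) * d) = 2 * d := by ring
    linarith
  have e2 : (1 - 2 / (d : ℝ)) / (d : ℝ) ^ 2 = 2 / (d : ℝ) ^ 2 - 2 / (d : ℝ) ^ 3 -
    2 / d * (1 / d) + (1 / (d : ℝ)) ^ 2 := by field_simp; ring
  rw [e2]
  linarith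

theorem E_csq_a {P : Measure (Matrix.unitaryGroup (Fin d) ℂ)} (hP : IsHaarU P) (j k : Fin d) :
    ∫ Ψ, csq Ψ j k ^ 2 * sqn Ψ j k ∂P ≤ 7 / (d : ℝ) ^ 3 := by
  have := hP.prob
  have hd0 : (0 : ℝ) < d := by exact_mod_cast k.pos
  have h1 : ∫ Ψ, csq Ψ j k ^ 2 * sqn Ψ j k ∂P ≤
      ∫ Ψ, (sqn Ψ j k ^ 3 + (1 / (d : ℝ)) ^ 2 * sqn Ψ j k) ∂P := by
    apply integral_mono (hP.integrable (by fun_prop)) (hP.integrable (by fun_prop))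
    intro Ψ
    have h0 := sqn_nonneg Ψ j k
    have : 0 ≤ (2 / (d : ℝ)) * sqn Ψ j k ^ 2 := by positivity
    have e : csq Ψ j k ^ 2 * sqn Ψ j k = sqn Ψ j k ^ 3 + (1 / (d : ℝ)) ^ 2 * sqn Ψ j k -
      (2 / (d : ℝ)) * sqn Ψ j k ^ 2 := by unfold csq; ring
    dsimp only
    linarith
  rw [integral_add (hP.integrable (by fun_prop)) (hP.integrable (by fun_prop)),
    integral_const_mul, E_a hP] at h1
  have h2 := sqn_moment_le hP 3 j k
  rw [show (3 : ℕ).factorial = 6 from rfl] at h2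
  refine h1.trans ((add_le_add_left h2 _).trans (le_of_eq ?_))
  push_cast
  field_simp
  norm_num

theorem E_csq_c {P : Measure (Matrix.unitaryGroup (Fin d) ℂ)} (hP : IsHaarU P) (hd : 2 ≤ d)
    (j k m : Fin d) (hkm : k ≠ m) :
    (1 - 9 / (d : ℝ)) / (d : ℝ) ^ 3 ≤ ∫ Ψ, csq Ψ j k ^ 2 * sqn Ψ j m ∂P := by
  have hd2 : (2 : ℝ) ≤ d := by exact_mod_cast hd
  have h := row_col hP {k} m j (by simpa using hkm.symm) (fun Ψ => (csq Ψ j k : ℂ)) (by fun_prop)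
    (fun Ψ Φ h => by
      have h1 : csq Ψ j k = csq Φ j k := by rw [csq, csq, sqn, sqn, h j k (by simp)]
      simp only [h1])
  simp only [norm_csq, sum_singleton, card_singleton] at h
  rw [integral_sub (hP.integrable (by fun_prop)) (hP.integrable (by fun_prop))] at h
  have h1 := E_csq_sq hP j k
  have h2 := E_csq_a hP j k
  rw [Nat.cast_sub (by omega)] at h
  have h0 : 0 ≤ ∫ Ψ, csq Ψ j k ^ 2 * sqn Ψ j m ∂P :=
    integral_nonneg fun Ψ => mul_nonneg (sq_nonneg _) (sqn_nonneg _ _ _)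
  set E := ∫ Ψ, csq Ψ j k ^ 2 * sqn Ψ j m ∂P
  have : (1 - 9 / (d : ℝ)) / (d : ℝ) ^ 3 * d ≤ E * d := by
    have e : (1 - 9 / (d : ℝ)) / (d : ℝ) ^ 3 * d =
      (1 - 2 / (d : ℝ)) / (d : ℝ) ^ 2 - 7 / (d : ℝ) ^ 3 := by field_simp; ring
    rw [e]
    push_cast at h
    linarith
  exact le_of_mul_le_mul_right this (by linarith)

theorem csq_T (Ψ : Matrix.unitaryGroup (Fin d) ℂ) (k m : Fin d) :
    ∑ j, csq Ψ j k * sqn Ψ j m = ∑ j, sqn Ψ j k * sqn Ψ j m - 1 / (d : ℝ) := by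
  simp only [csq, sub_mul, sum_sub_distrib, ← mul_sum, sqn_sum_row, mul_one]

theorem lower_case2 {P : Measure (Matrix.unitaryGroup (Fin d) ℂ)} (hP : IsHaarU P) (hd : 4 ≤ d)
    (k m : Fin d) (hkm : k ≠ m) (C : ℝ)
    (hT : ∫ Ψ, (∑ j, sqn Ψ j k * sqn Ψ j m) ^ 2 ∂P ≤ (1 + C / d) / (d : ℝ) ^ 2) :
    (1 - (27 + C) / (d : ℝ)) / (d : ℝ) ^ 2 ≤
    ∫ Ψ, (∑ j, ‖(csq Ψ j k : ℂ) * (starRingEnd ℂ) (ent Ψ j m)‖ ^ 2 -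
      ∑ r ∈ {k, m}, ‖∑ j, ((csq Ψ j k : ℂ) * (starRingEnd ℂ) (ent Ψ j m)) * ent Ψ j r‖ ^ 2) ∂P := by
  have := hP.prob
  have hd0 : (0 : ℝ) < d := by exact_mod_cast k.pos
  have key : ∀ (Ψ : Matrix.unitaryGroup (Fin d) ℂ), ∑ r ∈ {k, m},
      ‖∑ j, ((csq Ψ j k : ℂ) * (starRingEnd ℂ) (ent Ψ j m)) * ent Ψ j r‖ ^ 2 =
      ‖∑ j, ((csq Ψ j k : ℂ) * (starRingEnd ℂ) (ent Ψ j k)) * ent Ψ j m‖ ^ 2 +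
      (∑ j, sqn Ψ j k * sqn Ψ j m - 1 / (d : ℝ)) ^ 2 := by
    intro Ψ
    rw [sum_pair hkm]
    congr 1
    · rw [← RCLike.norm_conj, map_sum]
      congr 2; apply sum_congr rfl; intro j _
      simp only [map_mul, RingHomCompTriple.comp_apply, RingHom.id_apply, Complex.conj_ofReal]
      ring
    · have hs : ∑ j, ((csq Ψ j k : ℂ) * (starRingEnd ℂ) (ent Ψ j m)) * ent Ψ j m =
          ((∑ j, csq Ψ j k * sqn Ψ j m : ℝ) : ℂ) := by
        push_cast
        apply sum_congr rfl; intro j _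
        rw [mul_assoc, Complex.conj_mul', sqn]
        push_cast; rfl
      rw [hs, Complex.norm_real, Real.norm_eq_abs, sq_abs, csq_T]
  simp only [key]
  have b1 := w_bound hP {k} m (by simp [hkm.symm])
    (fun Ψ j => (csq Ψ j k : ℂ) * (starRingEnd ℂ) (ent Ψ j k))
    (fun j => by fun_prop) (fun Ψ Φ h => by
      funext j
      have h1 : ent Ψ j k = ent Φ j k := h j k (by simp)
      have h2 : csq Ψ j k = csq Φ j k := by rw [csq, csq, sqn, sqn, h j k (by simp)]
      rw [h1, h2]) (by rw [card_singleton]; omega) 7 (by norm_num) (fun j => by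
      have := E_csq_a hP j k
      simpa only [norm_mul, mul_pow, norm_csq, norm_conj_ent, pow_one] using this)
  have b2 : ∫ Ψ, (∑ j, sqn Ψ j k * sqn Ψ j m - 1 / (d : ℝ)) ^ 2 ∂P ≤ (C + 4) / (d : ℝ) ^ 3 := by
    have e : ∀ Ψ : Matrix.unitaryGroup (Fin d) ℂ, (∑ j, sqn Ψ j k * sqn Ψ j m - 1 / (d : ℝ)) ^ 2 =
      (∑ j, sqn Ψ j k * sqn Ψ j m) ^ 2 - (2 / (d : ℝ)) * (∑ j, sqn Ψ j k * sqn Ψ j m) +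
      (1 / (d : ℝ)) ^ 2 := by intro Ψ; ring
    simp only [e]
    rw [integral_add (hP.integrable (by fun_prop)) (hP.integrable (by fun_prop)),
      integral_sub (hP.integrable (by fun_prop)) (hP.integrable (by fun_prop)), integral_const_mul,
      integral_finsetSum _ (fun f _ => hP.integrable (by fun_prop))]
    simp only [integral_const, probReal_univ, one_smul]
    have hS := card_nsmul_le_sum univ _ _ (fun j _ => E_ab hP (by omega) j k m hkm)
    rw [card_univ, Fintype.card_fin, nsmul_eq_mul] at hS
    have hS2 := mul_le_mul_of_nonneg_left hS (by positivity : 0 ≤ 2 / (d : ℝ))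
    have e : (C + 4) / (d : ℝ) ^ 3 = (1 + C / d) / (d : ℝ) ^ 2 -
      2 / d * (d * ((1 - 2 / (d : ℝ)) / (d : ℝ) ^ 2)) + (1 / (d : ℝ)) ^ 2 := by field_simp; ring
    rw [e]
    linarith
  rw [integral_sub (hP.integrable (by fun_prop)) (hP.integrable (by fun_prop)),
    integral_add (hP.integrable (by fun_prop)) (hP.integrable (by fun_prop)),
    integral_finsetSum _ (fun f _ => hP.integrable (by fun_prop))]
  have hS := card_nsmul_le_sum univ _ _ (fun j _ => E_csq_c hP (by omega) j k m hkm)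
  rw [card_univ, Fintype.card_fin, nsmul_eq_mul] at hS
  have e : (1 - (27 + C) / (d : ℝ)) / (d : ℝ) ^ 2 = d * ((1 - 9 / (d : ℝ)) / (d : ℝ) ^ 3) -
    (2 * 7 / (d : ℝ) ^ 3 + (C + 4) / (d : ℝ) ^ 3) := by field_simp; ring
  rw [e]
  simp only [norm_mul, mul_pow, norm_csq, norm_conj_ent] at hS b1 b2 ⊢
  linarith

end

end Lower2

section Final

open Finset

theorem gam_eq {d : ℕ} (Ψ : Matrix.unitaryGroup (Fin d) ℂ) (k l m n : Fin d)
    (h1 : ¬(k = l ∧ m = n)) (h2 : ¬(k = n ∧ l = m)) :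
    gam Ψ.1 k l m n = ∑ j, ((starRingEnd ℂ) (ent Ψ j k) * ent Ψ j l *
      (starRingEnd ℂ) (ent Ψ j m)) * ent Ψ j n := by
  simp only [gam, if_neg h1, if_neg h2, mul_zero, sub_zero, ent_def]

theorem orth {d : ℕ} (Ψ : Matrix.unitaryGroup (Fin d) ℂ) (m n : Fin d) (h : m ≠ n) :
    ∑ j, (starRingEnd ℂ) (ent Ψ j m) * ent Ψ j n = 0 := by
  have := Matrix.mem_unitaryGroup_iff'.1 Ψ.2
  have := congrFun (congrFun this m) n
  rw [Matrix.mul_apply, Matrix.one_apply_ne h] at this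
  exact this

theorem gam_eq2 {d : ℕ} (Ψ : Matrix.unitaryGroup (Fin d) ℂ) (k m n : Fin d)
    (hkn : k ≠ n) (hmn : m ≠ n) :
    gam Ψ.1 k k m n = ∑ j, ((csq Ψ j k : ℂ) * (starRingEnd ℂ) (ent Ψ j m)) * ent Ψ j n := by
  rw [gam_eq Ψ k k m n (by simp [hmn]) (by simp [hkn])]
  have : ∀ j, ((csq Ψ j k : ℂ) * (starRingEnd ℂ) (ent Ψ j m)) * ent Ψ j n =
      ((starRingEnd ℂ) (ent Ψ j k) * ent Ψ j k * (starRingEnd ℂ) (ent Ψ j m)) * ent Ψ j n -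
      (1 / (d : ℂ)) * ((starRingEnd ℂ) (ent Ψ j m) * ent Ψ j n) := by
    intro j
    rw [Complex.conj_mul', csq, sqn, ent_def]
    push_cast; ring
  simp only [this]
  rw [sum_sub_distrib, ← mul_sum, orth Ψ m n hmn, mul_zero, sub_zero]

theorem mixed_zero {d : ℕ} [MeasurableSpace (Matrix.unitaryGroup (Fin d) ℂ)]
    [BorelSpace (Matrix.unitaryGroup (Fin d) ℂ)]
    {P : Measure (Matrix.unitaryGroup (Fin d) ℂ)} (hP : IsHaarU P) (p q : ℕ) (hpq : p ≠ q)
    (k l m n : Fin d) (hkn : k ≠ n) (hln : l ≠ n) (hmn : m ≠ n) :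
    (∫ Ψ, gam Ψ.1 k l m n ^ p * (starRingEnd ℂ) (gam Ψ.1 k l m n) ^ q ∂P) = 0 := by
  set θ : ℝ := Real.pi / ((p : ℝ) - q) with hθ
  set c : ℂ := Complex.exp (θ * Complex.I) with hc
  have hcc : (starRingEnd ℂ) c = Complex.exp (-(θ * Complex.I)) := by
    rw [hc, ← Complex.exp_conj]; simp
  have hc1 : (starRingEnd ℂ) c * c = 1 := by
    rw [hcc, hc, ← Complex.exp_add]; simp
  have hpq' : (p : ℂ) - q ≠ 0 := by
    rw [sub_ne_zero]; exact_mod_cast hpq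
  have hphase : c ^ p * (starRingEnd ℂ) c ^ q = -1 := by
    rw [hcc, hc, ← Complex.exp_nat_mul, ← Complex.exp_nat_mul, ← Complex.exp_add,
      ← Complex.exp_pi_mul_I]
    congr 1
    rw [hθ]; push_cast
    field_simp
    ring
  let g : Matrix.unitaryGroup (Fin d) ℂ := ⟨Matrix.diagonal fun i => if i = n then c else 1, by
    rw [Matrix.mem_unitaryGroup_iff', Matrix.star_eq_conjTranspose, Matrix.diagonal_conjTranspose,
      Matrix.diagonal_mul_diagonal, ← Matrix.diagonal_one]
    congr 1
    funext i
    by_cases h : i = n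
    · simpa [h] using hc1
    · simp [h]⟩
  have hg : ∀ (Ψ : Matrix.unitaryGroup (Fin d) ℂ) i r,
      (Ψ * g).1 i r = Ψ.1 i r * (if r = n then c else 1) := by
    intro Ψ i r
    exact Matrix.mul_diagonal _ _ _ _
  have hgam : ∀ Ψ : Matrix.unitaryGroup (Fin d) ℂ,
      gam (Ψ * g).1 k l m n = c * gam Ψ.1 k l m n := by
    intro Ψ
    rw [gam_eq (Ψ * g) k l m n (by simp [hmn]) (by simp [hkn]),
      gam_eq Ψ k l m n (by simp [hmn]) (by simp [hkn]), mul_sum]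
    apply sum_congr rfl; intro j _
    simp only [← ent_def, hg, if_neg hkn, if_neg hln, if_neg hmn, if_true, mul_one]
    ring
  have h := hP.right (fun Ψ => gam Ψ.1 k l m n ^ p * (starRingEnd ℂ) (gam Ψ.1 k l m n) ^ q) g
  simp only [hgam, map_mul, mul_pow] at h
  have e : ∀ Ψ : Matrix.unitaryGroup (Fin d) ℂ,
      c ^ p * gam Ψ.1 k l m n ^ p * ((starRingEnd ℂ) c ^ q * (starRingEnd ℂ) (gam Ψ.1 k l m n) ^ q) =
      -(gam Ψ.1 k l m n ^ p * (starRingEnd ℂ) (gam Ψ.1 k l m n) ^ q) := by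
    intro Ψ
    have : c ^ p * gam Ψ.1 k l m n ^ p * ((starRingEnd ℂ) c ^ q * (starRingEnd ℂ) (gam Ψ.1 k l m n) ^ q) =
      (c ^ p * (starRingEnd ℂ) c ^ q) * (gam Ψ.1 k l m n ^ p * (starRingEnd ℂ) (gam Ψ.1 k l m n) ^ q) := by
      ring
    rw [this, hphase]; ring
  simp only [e] at h
  rw [integral_neg] at h
  exact self_eq_neg.1 h.symm

theorem case1 (p : ℕ) (hp : p ≠ 0) : ∃ C : ℝ, 0 ≤ C ∧ ∃ D : ℕ, ∀ d : ℕ, D ≤ d →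
    ∀ [MeasurableSpace (Matrix.unitaryGroup (Fin d) ℂ)]
      [BorelSpace (Matrix.unitaryGroup (Fin d) ℂ)]
      (P : Measure (Matrix.unitaryGroup (Fin d) ℂ)), IsHaarU P → ∀ k l m n : Fin d,
      k ≠ l → k ≠ m → k ≠ n → l ≠ m → l ≠ n → m ≠ n →
            |(∫ Ψ, ‖gam Ψ.1 k l m n‖ ^ (2 * p) ∂P) -
              (p.factorial : ℝ) / (d : ℝ) ^ (3 * p)| ≤ C / (d : ℝ) ^ (3 * p + 1) := by
  obtain ⟨C1, hC1, D1, h1⟩ := S_bound p hp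
  obtain ⟨C2, hC2, D2, h2⟩ := final_upper p 3 C1 hC1
  obtain ⟨C3, hC3, D3, h3⟩ := final_lower p 146 (by norm_num)
  refine ⟨max C2 C3, le_max_of_le_left hC2, D1 + D2 + D3 + 4,
    fun d hd _ _ P hP k l m n hkl hkm hkn hlm hln hmn => ?_⟩
  have hcard : ({k, l, m} : Finset (Fin d)).card = 3 := card_eq_three.2 ⟨k, l, m, hkl, hkm, hlm, rfl⟩
  have hcont : ∀ j, Continuous fun Ψ : Matrix.unitaryGroup (Fin d) ℂ =>
    (starRingEnd ℂ) (ent Ψ j k) * ent Ψ j l * (starRingEnd ℂ) (ent Ψ j m) := fun j => by fun_prop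
  have hK : ∀ Ψ Φ : Matrix.unitaryGroup (Fin d) ℂ, (∀ j, ∀ r ∈ ({k, l, m} : Finset (Fin d)), Ψ.1 j r = Φ.1 j r) →
      (fun j => (starRingEnd ℂ) (ent Ψ j k) * ent Ψ j l * (starRingEnd ℂ) (ent Ψ j m)) =
      (fun j => (starRingEnd ℂ) (ent Φ j k) * ent Φ j l * (starRingEnd ℂ) (ent Φ j m)) := by
    intro Ψ Φ h
    funext j
    have h1 : ent Ψ j k = ent Φ j k := h j k (by simp)
    have h2 : ent Ψ j l = ent Φ j l := h j l (by simp)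
    have h3 : ent Ψ j m = ent Φ j m := h j m (by simp)
    rw [h1, h2, h3]
  have hn : n ∉ ({k, l, m} : Finset (Fin d)) := by simp [hkn.symm, hln.symm, hmn.symm]
  have hup := col_upper hP p {k, l, m} n hn
    (fun Ψ j => (starRingEnd ℂ) (ent Ψ j k) * ent Ψ j l * (starRingEnd ℂ) (ent Ψ j m)) hcont hK
  have hlo := col_lower hP p {k, l, m} n hn
    (fun Ψ j => (starRingEnd ℂ) (ent Ψ j k) * ent Ψ j l * (starRingEnd ℂ) (ent Ψ j m)) hcont hK
  have hx := lower_case1 hP (by omega) k l m hkl hkm hlm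
  have hlo2 := h3 d (by omega) _ _ hlo hx
  have hY := h1 d (by omega) P hP k l m hkl hkm hlm
  simp only [norm_mul _ ((starRingEnd ℂ) (ent _ _ m)), norm_mul _ (ent _ _ l), mul_pow,
    sum_subset_norm, norm_conj_ent, hcard] at hup
  have hup2 := h2 d (by omega) _ _ hup (integral_nonneg fun Ψ => pow_nonneg (sum_nonneg fun j _ =>
    mul_nonneg (mul_nonneg (sqn_nonneg _ _ _) (sqn_nonneg _ _ _)) (sqn_nonneg _ _ _)) _) hY
  have hge : ∀ Ψ : Matrix.unitaryGroup (Fin d) ℂ, gam Ψ.1 k l m n = ∑ j, ((starRingEnd ℂ) (ent Ψ j k) * ent Ψ j l *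
      (starRingEnd ℂ) (ent Ψ j m)) * Ψ.1 j n := fun Ψ => gam_eq Ψ k l m n (by simp [hmn]) (by simp [hkn])
  simp only [hge]
  have hd0 : (0 : ℝ) < d := by exact_mod_cast k.pos
  have m1 : C2 / (d : ℝ) ^ (3 * p + 1) ≤ max C2 C3 / (d : ℝ) ^ (3 * p + 1) :=
    div_le_div_of_nonneg_right (le_max_left _ _) (by positivity)
  have m2 : C3 / (d : ℝ) ^ (3 * p + 1) ≤ max C2 C3 / (d : ℝ) ^ (3 * p + 1) :=
    div_le_div_of_nonneg_right (le_max_right _ _) (by positivity)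
  rw [abs_le]
  constructor <;> linarith

theorem case2 (p : ℕ) (hp : p ≠ 0) : ∃ C : ℝ, 0 ≤ C ∧ ∃ D : ℕ, ∀ d : ℕ, D ≤ d →
    ∀ [MeasurableSpace (Matrix.unitaryGroup (Fin d) ℂ)]
      [BorelSpace (Matrix.unitaryGroup (Fin d) ℂ)]
      (P : Measure (Matrix.unitaryGroup (Fin d) ℂ)), IsHaarU P → ∀ k m n : Fin d,
      k ≠ m → k ≠ n → m ≠ n →
            |(∫ Ψ, ‖gam Ψ.1 k k m n‖ ^ (2 * p) ∂P) -
              (p.factorial : ℝ) / (d : ℝ) ^ (3 * p)| ≤ C / (d : ℝ) ^ (3 * p + 1) := by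
  obtain ⟨C0, hC0, D0, h0⟩ := T_bound 2 (by norm_num)
  obtain ⟨C1, hC1, D1, h1⟩ := W_bound p hp
  obtain ⟨C2, hC2, D2, h2⟩ := final_upper p 2 C1 hC1
  obtain ⟨C3, hC3, D3, h3⟩ := final_lower p (27 + C0) (by positivity)
  refine ⟨max C2 C3, le_max_of_le_left hC2, D0 + D1 + D2 + D3 + 4,
    fun d hd _ _ P hP k m n hkm hkn hmn => ?_⟩
  have hcont : ∀ j, Continuous fun Ψ : Matrix.unitaryGroup (Fin d) ℂ =>
    (csq Ψ j k : ℂ) * (starRingEnd ℂ) (ent Ψ j m) := fun j => by fun_prop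
  have hK : ∀ Ψ Φ : Matrix.unitaryGroup (Fin d) ℂ, (∀ j, ∀ r ∈ ({k, m} : Finset (Fin d)), Ψ.1 j r = Φ.1 j r) →
      (fun j => (csq Ψ j k : ℂ) * (starRingEnd ℂ) (ent Ψ j m)) =
      (fun j => (csq Φ j k : ℂ) * (starRingEnd ℂ) (ent Φ j m)) := by
    intro Ψ Φ h
    funext j
    have h1 : csq Ψ j k = csq Φ j k := by rw [csq, csq, sqn, sqn, h j k (by simp)]
    have h3 : ent Ψ j m = ent Φ j m := h j m (by simp)
    rw [h1, h3]
  have hn : n ∉ ({k, m} : Finset (Fin d)) := by simp [hkn.symm, hmn.symm]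
  have hup := col_upper hP p {k, m} n hn
    (fun Ψ j => (csq Ψ j k : ℂ) * (starRingEnd ℂ) (ent Ψ j m)) hcont hK
  have hlo := col_lower hP p {k, m} n hn
    (fun Ψ j => (csq Ψ j k : ℂ) * (starRingEnd ℂ) (ent Ψ j m)) hcont hK
  have hx := lower_case2 hP (by omega) k m hkm C0 (h0 d (by omega) P hP k m hkm)
  have hlo2 := h3 d (by omega) _ _ hlo hx
  have hY := h1 d (by omega) P hP k m hkm
  simp only [norm_mul _ ((starRingEnd ℂ) (ent _ _ m)), mul_pow,
    norm_csq, norm_conj_ent, card_pair hkm] at hup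
  have hup2 := h2 d (by omega) _ _ hup (integral_nonneg fun Ψ => pow_nonneg (sum_nonneg fun j _ =>
    mul_nonneg (sq_nonneg _) (sqn_nonneg _ _ _)) _) hY
  have hge : ∀ Ψ : Matrix.unitaryGroup (Fin d) ℂ, gam Ψ.1 k k m n = ∑ j, ((csq Ψ j k : ℂ) *
      (starRingEnd ℂ) (ent Ψ j m)) * Ψ.1 j n := fun Ψ => gam_eq2 Ψ k m n hkn hmn
  simp only [hge]
  have hd0 : (0 : ℝ) < d := by exact_mod_cast k.pos
  have m1 : C2 / (d : ℝ) ^ (3 * p + 1) ≤ max C2 C3 / (d : ℝ) ^ (3 * p + 1) :=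
    div_le_div_of_nonneg_right (le_max_left _ _) (by positivity)
  have m2 : C3 / (d : ℝ) ^ (3 * p + 1) ≤ max C2 C3 / (d : ℝ) ^ (3 * p + 1) :=
    div_le_div_of_nonneg_right (le_max_right _ _) (by positivity)
  rw [abs_le]
  constructor <;> linarith

end Final

/-- Moments of `γ(k,ℓ,m,n)` for pairwise distinct indices (and for the type `kkmn`):
mixed moments with `p ≠ q` vanish, and `E|γ|^{2p} = p! d^{-3p} + O_p(d^{-3p-1})`. -/
theorem stmt11 (p q : ℕ) (hpq : ¬(p = 0 ∧ q = 0)) :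
    (∀ (d : ℕ) [MeasurableSpace (Matrix.unitaryGroup (Fin d) ℂ)]
      [BorelSpace (Matrix.unitaryGroup (Fin d) ℂ)]
      (P : Measure (Matrix.unitaryGroup (Fin d) ℂ)) [IsProbabilityMeasure P],
      (∀ g : Matrix.unitaryGroup (Fin d) ℂ, P.map (fun x => g * x) = P) →
      p ≠ q →
      ∀ k l m n : Fin d,
        (k ≠ l → k ≠ m → k ≠ n → l ≠ m → l ≠ n → m ≠ n →
          (∫ Ψ, gam Ψ.1 k l m n ^ p *
            (starRingEnd ℂ) (gam Ψ.1 k l m n) ^ q ∂P) = 0) ∧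
        (k ≠ m → k ≠ n → m ≠ n →
          (∫ Ψ, gam Ψ.1 k k m n ^ p *
            (starRingEnd ℂ) (gam Ψ.1 k k m n) ^ q ∂P) = 0)) ∧
    ∃ C > (0 : ℝ), ∃ D : ℕ, ∀ d : ℕ, D ≤ d →
      ∀ [MeasurableSpace (Matrix.unitaryGroup (Fin d) ℂ)]
        [BorelSpace (Matrix.unitaryGroup (Fin d) ℂ)]
        (P : Measure (Matrix.unitaryGroup (Fin d) ℂ)) [IsProbabilityMeasure P],
        (∀ g : Matrix.unitaryGroup (Fin d) ℂ, P.map (fun x => g * x) = P) →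
        ∀ k l m n : Fin d,
          (k ≠ l → k ≠ m → k ≠ n → l ≠ m → l ≠ n → m ≠ n →
            |(∫ Ψ, ‖gam Ψ.1 k l m n‖ ^ (2 * p) ∂P) -
              (p.factorial : ℝ) / (d : ℝ) ^ (3 * p)| ≤ C / (d : ℝ) ^ (3 * p + 1)) ∧
          (k ≠ m → k ≠ n → m ≠ n →
            |(∫ Ψ, ‖gam Ψ.1 k k m n‖ ^ (2 * p) ∂P) -
              (p.factorial : ℝ) / (d : ℝ) ^ (3 * p)| ≤ C / (d : ℝ) ^ (3 * p + 1)) := by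
  constructor
  · intro d _ _ P hprob hinv hne k l m n
    have hP : IsHaarU P := ⟨hprob, hinv⟩
    exact ⟨fun _ _ hkn _ hln hmn => mixed_zero hP p q hne k l m n hkn hln hmn,
      fun _ hkn hmn => mixed_zero hP p q hne k k m n hkn hkn hmn⟩
  · by_cases hp : p = 0
    · subst hp
      refine ⟨1, one_pos, 0, fun d _ _ _ P _ _ k l m n => ?_⟩
      simp
    obtain ⟨C1, hC1, D1, h1⟩ := case1 p hp
    obtain ⟨C2, hC2, D2, h2⟩ := case2 p hp
    refine ⟨C1 + C2 + 1, by positivity, D1 + D2, fun d hd _ _ P hprob hinv k l m n => ?_⟩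
    have hP : IsHaarU P := ⟨hprob, hinv⟩
    have hd0 : (0 : ℝ) < d := by exact_mod_cast k.pos
    refine ⟨fun a b c e f g => (h1 d (by omega) P hP k l m n a b c e f g).trans ?_,
      fun a b c => (h2 d (by omega) P hP k m n a b c).trans ?_⟩
    · exact div_le_div_of_nonneg_right (by linarith) (by positivity)
    · exact div_le_div_of_nonneg_right (by linarith) (by positivity)
end
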